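/- Conventions are those of Penrose–Rindler: signature $(+,-,-,-)$, $\kappa_B=\kappa^A\epsilon_{AB}$, $T\mathcal M\otimes\mathbb C\cong\mathbb S\otimes\bar{\mathbb S}$ and $g_{ab}=\epsilon_{AB}\bar\epsilon_{A'B'}$. Let $(\mathcal M,g)$ be a real smooth 4-dimensional Lorentzian spin manifold with Levi-Civita connection $\nabla_{AA'}$. Assume that it is Einstein: the trace-free Ricci spinor vanishes, $\Phi_{ABA'B'}=0$, and $\Lambda=R/24$ is constant. Let $(o^A,\iota^A)$ be a smooth spin dyad, $o_A\iota^A=1$, in which the Weyl spinor $\Psi_{ABCD}$ is of Petrov type II with repeated principal spinor $o^A$, that is, $\Psi_0=\Psi_1=0$ and $\Psi_2\neq0$ everywhere, where $\Psi_0=\Psi_{ABCD}o^Ao^Bo^Co^D$, $\Psi_1=\Psi_{ABCD}o^Ao^Bo^C\iota^D$, $\Psi_2=\Psi_{ABCD}o^Ao^B\iota^C\iota^D$. Put $l^a=o^A\bar o^{A'}$, $n^a=\iota^A\bar\iota^{A'}$, $m^a=o^A\bar\iota^{A'}$, $\bar m^a=\iota^A\bar o^{A'}$, and $$\rho=o^A\bar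 m^b\nabla_b o_A,\quad \tau=o^An^b\nabla_bo_A,\quad \sigma'=-\iota^A\bar m^b\nabla_b\iota_A,\quad \tau'=-\iota^Al^b\nabla_b\iota_A .$$ On scalars and spinors of GHP weight $\{p,q\}$ the GHP derivative is $\Theta_a=\nabla_a+p\,\omega_a+q\,\bar\omega_a$ with $\omega_a=-\iota^B\nabla_ao_B$. Put $\text{þ}=l^a\Theta_a$, $\eth=m^a\Theta_a$ (on a scalar of weight $\{p,q\}$ they give scalars of weight $\{p+1,q+1\}$ and $\{p+1,q-1\}$), and $\tilde\Theta_{A'}=o^A\Theta_{AA'}$ (from weight $\{p,q\}$ to $\{p+1,q\}$). Let $\chi$ be a smooth complex scalar field of GHP weight $\{-4,0\}$ and let the Debye metric generated by $\chi$ be $$h_{ab}=\mathcal S^\dagger(\chi)_{ab}=h_{nn}\,l_al_b-2h_{n\bar m}\,l_{(a}m_{b)}+h_{\bar m\bar m}\,m_am_b,$$ $$h_{nn}=-(\eth+2\tau)\eth\chi-\bar\sigma'\text{þ}\chi,\quad h_{n\bar m}=-(\text{þ}+\rho)\eth\chi-(\tau+\bar\tau')\text{þ}\chi,\quad h_{\bar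 m\bar m}=-(\text{þ}+2\rho)\text{þ}\chi .$$ Let $\phi=\Psi_2^{1/3}$, i.e. $\phi$ is any smooth function (of weight $\{0,0\}$) with $\phi^3=\Psi_2$. Then $$h_{AA'BB'}=o_Ao_B\,X_{A'B'},\qquad X_{A'B'}=-\phi^{-2}\,\tilde\Theta_{(A'}\bigl(\phi^{2}\,\tilde\Theta_{B')}\chi\bigr).$$ -/

import Mathlib

open scoped Manifold ContDiff ComplexConjugate

noncomputable section

/-! ### Two-component spinor algebra

Unprimed and primed spinor indices both run over `Fin 2`.  Conventions are those of Penrose and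
Rindler: signature `(+,-,-,-)`, `ε₀₁ = ε⁰¹ = 1`, `κ_B = κ^A ε_{AB}`, `κ^A = ε^{AB} κ_B`. -/

/-- The numerical matrix of `ε_{AB}`; the same matrix gives `ε^{AB}`, `ε_{A'B'}` and `ε^{A'B'}`. -/
def spinEps : Matrix (Fin 2) (Fin 2) ℂ := !![0, 1; -1, 0]

/-- The matrices `1, σ_x, σ_y, σ_z`. -/
def pauli : Fin 4 → Matrix (Fin 2) (Fin 2) ℂ :=
  ![!![1, 0; 0, 1], !![0, 1; 1, 0], !![0, -Complex.I; Complex.I, 0], !![1, 0; 0, -1]]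

/-- Infeld–van der Waerden symbols `σ^i_{AA'}`: the complex vector fields of the spin basis are
`e_{AA'} = ∑ i, σ^i_{AA'} e_i` with `e_i` orthonormal. -/
def ivdW (i : Fin 4) (A A' : Fin 2) : ℂ := pauli i A A' / ((√2 : ℝ) : ℂ)

/-- Minkowski signs `η = diag(1,-1,-1,-1)`. -/
def minkSign : Fin 4 → ℝ := ![1, -1, -1, -1]

/-- Converts the components `T_i` of a (complex) covector in the orthonormal frame to its spinor
components `T_{AA'}`. -/
def toSpinor (T : Fin 4 → ℂ) (A A' : Fin 2) : ℂ := ∑ i, ivdW i A A' * T i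

/-- Lowering a spinor index, `κ_B = κ^A ε_{AB}` (for primed indices as well). -/
def lowerIdx (κ : Fin 2 → ℂ) (B : Fin 2) : ℂ := ∑ A, κ A * spinEps A B

/-! ### Lorentzian spin manifolds -/

/-- A (real, smooth, 4-dimensional) Lorentzian spin manifold.  The theorem concerns a manifold with
a spin dyad, and a dyad trivialises the spin bundle; so the spin bundle is `M × ℂ²`, and it is tied
to the geometry by a smooth orthonormal frame `e` through `e_{AA'} = σ^i_{AA'} e_i`.  As the four
vectors `e i x` are orthonormal, they are a basis of the tangent space; hence `g` is symmetric, of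
signature `(+,-,-,-)` and smooth, and `g(e_{AA'}, e_{BB'}) = ε_{AB} ε_{A'B'}`. -/
structure SpinSpacetime (M : Type*) [TopologicalSpace M]
    [ChartedSpace (EuclideanSpace ℝ (Fin 4)) M] [IsManifold (𝓡 4) ∞ M] where
  /-- the metric -/
  g : ∀ x : M, LinearMap.BilinForm ℝ (TangentSpace (𝓡 4) x)
  /-- the orthonormal frame that underlies the spin basis -/
  e : Fin 4 → ∀ x : M, TangentSpace (𝓡 4) x
  smooth_e : ∀ i, ContMDiff (𝓡 4) (𝓡 4).tangent ∞
    (fun x => (⟨x, e i x⟩ : TangentBundle (𝓡 4) M))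
  orthonormal : ∀ x i j, g x (e i x) (e j x) = if i = j then minkSign i else 0

/-- A spin dyad `(o^A, ι^A)`: two smooth spinor fields with `o_A ι^A = 1`.  Components refer to
the trivialisation `M × ℂ²` and are otherwise arbitrary. -/
structure SpinDyad (M : Type*) [TopologicalSpace M]
    [ChartedSpace (EuclideanSpace ℝ (Fin 4)) M] where
  o : M → Fin 2 → ℂ
  ι : M → Fin 2 → ℂ
  smooth_o : ∀ A, ContMDiff (𝓡 4) 𝓘(ℝ, ℂ) ∞ (fun x => o x A)
  smooth_ι : ∀ A, ContMDiff (𝓡 4) 𝓘(ℝ, ℂ) ∞ (fun x => ι x A)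
  normalised : ∀ x, ∑ A, lowerIdx (o x) A * ι x A = 1

namespace SpinSpacetime

variable {M : Type*} [TopologicalSpace M] [ChartedSpace (EuclideanSpace ℝ (Fin 4)) M]
  [IsManifold (𝓡 4) ∞ M]

/-- The derivative `e_i f` of a complex function. -/
def D (S : SpinSpacetime M) (i : Fin 4) (f : M → ℂ) (x : M) : ℂ :=
  mfderiv (𝓡 4) 𝓘(ℝ, ℂ) f x (S.e i x)

/-- Structure functions `c_{ijk} = g([e_i, e_j], e_k)`. -/
def structFn (S : SpinSpacetime M) (i j k : Fin 4) (x : M) : ℝ :=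
  S.g x (VectorField.mlieBracket (𝓡 4) (S.e i) (S.e j) x) (S.e k x)

/-- The Levi-Civita connection in the orthonormal frame, `Γ_{kij} = g(∇_{e_k} e_i, e_j)`, given by
the Koszul formula. -/
def leviCivita (S : SpinSpacetime M) (k i j : Fin 4) (x : M) : ℝ :=
  (S.structFn k i j x - S.structFn i j k x + S.structFn j k i x) / 2

/-- The Levi-Civita spin connection `ω_{kBC}` with both indices down, the part of `Γ` acting on
unprimed spinors: `Γ_{k BB' CC'} = ω_{kBC} ε_{B'C'} + ε_{BC} ω̄_{kB'C'}` with `ω_{kBC}` symmetric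
in `BC`, so that `ω_{kBC} = ½ ε^{B'C'} Γ_{k BB' CC'}`. -/
def spinConnLow (S : SpinSpacetime M) (k : Fin 4) (B C : Fin 2) (x : M) : ℂ :=
  (1 / 2) * ∑ B', ∑ C', spinEps B' C' *
    ∑ i, ∑ j, ivdW i B B' * ivdW j C C' * (S.leviCivita k i j x : ℂ)

/-- The coefficients `ω_{kB}{}^C = ε^{CD} ω_{kBD}`: on spinors, `∇_k κ^C = e_k κ^C + κ^B ω_{kB}{}^C`. -/
def spinConn (S : SpinSpacetime M) (k : Fin 4) (B C : Fin 2) (x : M) : ℂ :=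
  ∑ D, spinEps C D * S.spinConnLow k B D x

theorem structFn_antisymm (S : SpinSpacetime M) (i j k : Fin 4) (x : M) :
    S.structFn i j k x = -S.structFn j i k x := by
  unfold structFn
  rw [VectorField.mlieBracket_swap_apply, map_neg, LinearMap.neg_apply]

/-- The connection is metric. -/
theorem leviCivita_metric (S : SpinSpacetime M) (k i j : Fin 4) (x : M) :
    S.leviCivita k i j x = -S.leviCivita k j i x := by
  unfold leviCivita
  rw [S.structFn_antisymm k i j, S.structFn_antisymm i j k, S.structFn_antisymm j k i]
  ring

/-- The connection is torsion-free: `∇_{e_i} e_j - ∇_{e_j} e_i = [e_i, e_j]`. -/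
theorem leviCivita_torsion (S : SpinSpacetime M) (i j k : Fin 4) (x : M) :
    S.leviCivita i j k x - S.leviCivita j i k x = S.structFn i j k x := by
  unfold leviCivita
  rw [S.structFn_antisymm j i k, S.structFn_antisymm j k i, S.structFn_antisymm k i j]
  ring

/-- The covariant derivative `∇_k κ^C` of a spinor field along `e_k`. -/
def nabla (S : SpinSpacetime M) (k : Fin 4) (κ : M → Fin 2 → ℂ) (x : M) (C : Fin 2) : ℂ :=
  S.D k (fun y => κ y C) x + ∑ B, κ x B * S.spinConn k B C x

/-! ### Curvature spinors -/

/-- The spin curvature `F_{ijB}{}^C`, defined by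
`(∇_i ∇_j - ∇_j ∇_i - ∇_{[e_i,e_j]}) κ^C = F_{ijB}{}^C κ^B`. -/
def spinCurv (S : SpinSpacetime M) (i j : Fin 4) (B C : Fin 2) (x : M) : ℂ :=
  S.D i (S.spinConn j B C) x - S.D j (S.spinConn i B C) x
    + ∑ E, (S.spinConn j B E x * S.spinConn i E C x - S.spinConn i B E x * S.spinConn j E C x)
    - ∑ k, ((minkSign k * S.structFn i j k x : ℝ) : ℂ) * S.spinConn k B C x

/-- `F_{AA'BB'CD}`: spinor components of the spin curvature, all indices down. -/
def spinCurvLow (S : SpinSpacetime M) (A A' B B' C D : Fin 2) (x : M) : ℂ :=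
  ∑ i, ∑ j, ivdW i A A' * ivdW j B B' * lowerIdx (fun E => S.spinCurv i j C E x) D

/-- The curvature spinor `X_{ABCD}` in `F_{AA'BB'CD} = ε_{A'B'} X_{ABCD} + ε_{AB} Φ_{A'B'CD}`. -/
def curvX (S : SpinSpacetime M) (A B C D : Fin 2) (x : M) : ℂ :=
  (1 / 2) * ∑ A', ∑ B', spinEps A' B' * S.spinCurvLow A A' B B' C D x

/-- The trace-free Ricci spinor `Φ_{ABA'B'}`. -/
def ricciSpinor (S : SpinSpacetime M) (A B A' B' : Fin 2) (x : M) : ℂ :=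
  (1 / 2) * ∑ C, ∑ D, spinEps C D * S.spinCurvLow C A' D B' A B x

/-- `Λ = R/24 = (1/6) X_{AB}{}^{AB}`. -/
def scalarLambda (S : SpinSpacetime M) (x : M) : ℂ :=
  (1 / 6) * ∑ A, ∑ B, ∑ C, ∑ D, spinEps A C * spinEps B D * S.curvX A B C D x

/-- The Weyl spinor `Ψ_{ABCD} = X_{(ABCD)}`.  Since `X_{ABCD}` is symmetric in `AB` and in `CD`,
three terms suffice for the total symmetrisation. -/
def weylSpinor (S : SpinSpacetime M) (A B C D : Fin 2) (x : M) : ℂ :=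
  (1 / 3) * (S.curvX A B C D x + S.curvX A C D B x + S.curvX A D B C x)

/-- Full contraction `Ψ_{ABCD} α^A β^B γ^C δ^D`. -/
def weylContract (S : SpinSpacetime M) (α β γ δ : M → Fin 2 → ℂ) (x : M) : ℂ :=
  ∑ A, ∑ B, ∑ C, ∑ D, S.weylSpinor A B C D x * α x A * β x B * γ x C * δ x D

/-- The Weyl scalars `Ψ₀, Ψ₁, Ψ₂` of a dyad. -/
def Psi0 (S : SpinSpacetime M) (d : SpinDyad M) : M → ℂ := S.weylContract d.o d.o d.o d.o
def Psi1 (S : SpinSpacetime M) (d : SpinDyad M) : M → ℂ := S.weylContract d.o d.o d.o d.ι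
def Psi2 (S : SpinSpacetime M) (d : SpinDyad M) : M → ℂ := S.weylContract d.o d.o d.ι d.ι

/-- Einstein spacetimes: vanishing trace-free Ricci spinor and constant `Λ`. -/
def IsEinstein (S : SpinSpacetime M) : Prop :=
  (∀ A B A' B' x, S.ricciSpinor A B A' B' x = 0) ∧ ∃ c : ℝ, ∀ x, S.scalarLambda x = c

/-- Petrov type II with repeated principal spinor `o^A`: `Ψ₀ = Ψ₁ = 0` and `Ψ₂ ≠ 0` everywhere.
(For Einstein spacetimes `κ = σ = 0` is a consequence and is not assumed.) -/
def IsTypeII (S : SpinSpacetime M) (d : SpinDyad M) : Prop :=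
  ∀ x, S.Psi0 d x = 0 ∧ S.Psi1 d x = 0 ∧ S.Psi2 d x ≠ 0

/-! ### Spin coefficients and the GHP derivative -/

/-- `α^B ∇_k β_B` along `e_k`. -/
def connPair (S : SpinSpacetime M) (α β : M → Fin 2 → ℂ) (x : M) (k : Fin 4) : ℂ :=
  ∑ B, α x B * lowerIdx (S.nabla k β x) B

/-- `u^A v̄^{A'} T_{AA'}` for a covector with frame components `T_k`; thus `l, n, m, m̄` correspond
to `(u,v) = (o,o), (ι,ι), (o,ι), (ι,o)`. -/
def along (u v : Fin 2 → ℂ) (T : Fin 4 → ℂ) : ℂ :=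
  ∑ A, ∑ A', u A * conj (v A') * toSpinor T A A'

/-- `ρ = o^A δ' o_A`, with `δ' = m̄^a ∇_a`. -/
def rho (S : SpinSpacetime M) (d : SpinDyad M) (x : M) : ℂ :=
  along (d.ι x) (d.o x) (S.connPair d.o d.o x)

/-- `τ = o^A D' o_A`, with `D' = n^a ∇_a`. -/
def tau (S : SpinSpacetime M) (d : SpinDyad M) (x : M) : ℂ :=
  along (d.ι x) (d.ι x) (S.connPair d.o d.o x)

/-- `σ' = -ι^A δ' ι_A`. -/
def sigma' (S : SpinSpacetime M) (d : SpinDyad M) (x : M) : ℂ :=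
  -along (d.ι x) (d.o x) (S.connPair d.ι d.ι x)

/-- `τ' = -ι^A D ι_A`, with `D = l^a ∇_a`. -/
def tau' (S : SpinSpacetime M) (d : SpinDyad M) (x : M) : ℂ :=
  -along (d.o x) (d.o x) (S.connPair d.ι d.ι x)

/-- The GHP connection form `ω_a = -ι^B ∇_a o_B = -ε n_a + ε' l_a - β' m_a + β m̄_a`, along `e_k`. -/
def ghpForm (S : SpinSpacetime M) (d : SpinDyad M) (x : M) (k : Fin 4) : ℂ :=
  -S.connPair d.ι d.o x k

/-- The GHP derivative `Θ_k f = e_k f + (p ω_k + q ω̄_k) f` of a scalar of weight `{p,q}`, along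
`e_k`.  A weighted scalar is represented by its value with respect to the dyad `d`. -/
def ghpScalar (S : SpinSpacetime M) (d : SpinDyad M) (p q : ℤ) (f : M → ℂ) (x : M) (k : Fin 4) : ℂ :=
  S.D k f x + (p * S.ghpForm d x k + q * conj (S.ghpForm d x k)) * f x

/-- The GHP derivative `Θ_k Y_{B'} = ∇_k Y_{B'} + (p ω_k + q ω̄_k) Y_{B'}` of a primed spinor field
of weight `{p,q}` with a lower index, where `∇_k Y_{B'} = e_k Y_{B'} - ω̄_{kB'}{}^{C'} Y_{C'}`. -/
def ghpPrimed (S : SpinSpacetime M) (d : SpinDyad M) (p q : ℤ) (Y : M → Fin 2 → ℂ) (x : M)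
    (B' : Fin 2) (k : Fin 4) : ℂ :=
  S.D k (fun y => Y y B') x - ∑ C', conj (S.spinConn k B' C' x) * Y x C'
    + (p * S.ghpForm d x k + q * conj (S.ghpForm d x k)) * Y x B'

/-- `þ = l^a Θ_a` on scalars of weight `{p,q}`; the result has weight `{p+1,q+1}`. -/
def tho (S : SpinSpacetime M) (d : SpinDyad M) (p q : ℤ) (f : M → ℂ) (x : M) : ℂ :=
  along (d.o x) (d.o x) (S.ghpScalar d p q f x)

/-- `ð = m^a Θ_a` on scalars of weight `{p,q}`; the result has weight `{p+1,q-1}`. -/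
def edt (S : SpinSpacetime M) (d : SpinDyad M) (p q : ℤ) (f : M → ℂ) (x : M) : ℂ :=
  along (d.o x) (d.ι x) (S.ghpScalar d p q f x)

/-- `Θ̃_{A'} f = o^A Θ_{AA'} f` on scalars of weight `{p,q}`; the result has weight `{p+1,q}`. -/
def projScalar (S : SpinSpacetime M) (d : SpinDyad M) (p q : ℤ) (f : M → ℂ) (x : M)
    (A' : Fin 2) : ℂ :=
  ∑ A, d.o x A * toSpinor (S.ghpScalar d p q f x) A A'

/-- `Θ̃_{A'} Y_{B'} = o^A Θ_{AA'} Y_{B'}` on primed spinor fields of weight `{p,q}`. -/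
def projPrimed (S : SpinSpacetime M) (d : SpinDyad M) (p q : ℤ) (Y : M → Fin 2 → ℂ) (x : M)
    (A' B' : Fin 2) : ℂ :=
  ∑ A, d.o x A * toSpinor (S.ghpPrimed d p q Y x B') A A'

/-! ### The Debye metric -/

/-- `h_nn = -(ð + 2τ) ð χ - σ̄' þ χ`, for `χ` of weight `{-4,0}`. -/
def hnn (S : SpinSpacetime M) (d : SpinDyad M) (χ : M → ℂ) (x : M) : ℂ :=
  -(S.edt d (-3) (-1) (S.edt d (-4) 0 χ) x + 2 * S.tau d x * S.edt d (-4) 0 χ x)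
    - conj (S.sigma' d x) * S.tho d (-4) 0 χ x

/-- `h_nm̄ = -(þ + ρ) ð χ - (τ + τ̄') þ χ`. -/
def hnmbar (S : SpinSpacetime M) (d : SpinDyad M) (χ : M → ℂ) (x : M) : ℂ :=
  -(S.tho d (-3) (-1) (S.edt d (-4) 0 χ) x + S.rho d x * S.edt d (-4) 0 χ x)
    - (S.tau d x + conj (S.tau' d x)) * S.tho d (-4) 0 χ x

/-- `h_m̄m̄ = -(þ + 2ρ) þ χ`. -/
def hmbarmbar (S : SpinSpacetime M) (d : SpinDyad M) (χ : M → ℂ) (x : M) : ℂ :=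
  -(S.tho d (-3) 1 (S.tho d (-4) 0 χ) x + 2 * S.rho d x * S.tho d (-4) 0 χ x)

end SpinSpacetime

/-- The covector `l_a = o_A ō_{A'}`. -/
def SpinDyad.l {M : Type*} [TopologicalSpace M] [ChartedSpace (EuclideanSpace ℝ (Fin 4)) M]
    (d : SpinDyad M) (x : M) (A A' : Fin 2) : ℂ :=
  lowerIdx (d.o x) A * conj (lowerIdx (d.o x) A')

/-- The covector `m_a = o_A ῑ_{A'}`. -/
def SpinDyad.m {M : Type*} [TopologicalSpace M] [ChartedSpace (EuclideanSpace ℝ (Fin 4)) M]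
    (d : SpinDyad M) (x : M) (A A' : Fin 2) : ℂ :=
  lowerIdx (d.o x) A * conj (lowerIdx (d.ι x) A')

namespace SpinSpacetime

variable {M : Type*} [TopologicalSpace M] [ChartedSpace (EuclideanSpace ℝ (Fin 4)) M]
  [IsManifold (𝓡 4) ∞ M]

/-- The Debye metric `h_ab = S†(χ)_ab = h_nn l_a l_b - 2 h_nm̄ l_{(a} m_{b)} + h_m̄m̄ m_a m_b`, with
`a = AA'` and `b = BB'`. -/
def debyeMetric (S : SpinSpacetime M) (d : SpinDyad M) (χ : M → ℂ) (x : M)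
    (A A' B B' : Fin 2) : ℂ :=
  S.hnn d χ x * d.l x A A' * d.l x B B'
    - 2 * S.hnmbar d χ x * ((d.l x A A' * d.m x B B' + d.m x A A' * d.l x B B') / 2)
    + S.hmbarmbar d χ x * d.m x A A' * d.m x B B'

/-- `Y_{B'} = φ² Θ̃_{B'} χ`, for `χ` of weight `{-4,0}` and `φ` of weight `{0,0}`; it has weight
`{-3,0}`. -/
def debyeY (S : SpinSpacetime M) (d : SpinDyad M) (φ χ : M → ℂ) (x : M) (B' : Fin 2) : ℂ :=
  φ x ^ 2 * S.projScalar d (-4) 0 χ x B'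

/-- `X_{A'B'} = -φ⁻² Θ̃_{(A'} (φ² Θ̃_{B')} χ)`. -/
def debyeX (S : SpinSpacetime M) (d : SpinDyad M) (φ χ : M → ℂ) (x : M) (A' B' : Fin 2) : ℂ :=
  -((φ x ^ 2)⁻¹ * ((S.projPrimed d (-3) 0 (S.debyeY d φ χ) x A' B'
    + S.projPrimed d (-3) 0 (S.debyeY d φ χ) x B' A') / 2))

end SpinSpacetime

end

noncomputable section

section Fields

variable {M : Type*} [TopologicalSpace M] [ChartedSpace (EuclideanSpace ℝ (Fin 4)) M]
  [IsManifold (𝓡 4) ∞ M]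

theorem ofNat_le_infty (n : ℕ) : (n : ℕ∞ω) ≤ ∞ := by exact_mod_cast le_top

theorem isManifold_of_nat (n : ℕ) : IsManifold (𝓡 4) (n : ℕ∞ω) M :=
  IsManifold.of_le (n := ∞) (ofNat_le_infty n)

theorem isManifold_minSmoothness (n : ℕ) : IsManifold (𝓡 4) (minSmoothness ℝ n) M := by
  rw [minSmoothness_of_isRCLikeNormedField]
  exact isManifold_of_nat n

/-- Smooth vector fields. -/
def SmoothVF (V : ∀ x : M, TangentSpace (𝓡 4) x) : Prop :=
  ContMDiff (𝓡 4) (𝓡 4).tangent ∞ (fun x => (⟨x, V x⟩ : TangentBundle (𝓡 4) M))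

theorem SmoothVF.mdifferentiableAt {V : ∀ x : M, TangentSpace (𝓡 4) x} (hV : SmoothVF V) (x : M) :
    MDifferentiableAt (𝓡 4) (𝓡 4).tangent (fun x => (⟨x, V x⟩ : TangentBundle (𝓡 4) M)) x :=
  (hV x).mdifferentiableAt (by simp)

theorem SmoothVF.mlieBracket {V W : ∀ x : M, TangentSpace (𝓡 4) x} (hV : SmoothVF V)
    (hW : SmoothVF W) : SmoothVF (VectorField.mlieBracket (𝓡 4) V W) := by
  have : IsManifold (𝓡 4) (((⊤ : ℕ∞) : ℕ∞ω) + 1) M := by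
    have h : (((⊤ : ℕ∞) : ℕ∞ω) + 1) = ∞ := rfl
    rw [h]; infer_instance
  have : IsManifold (𝓡 4) (minSmoothness ℝ 2) M := isManifold_minSmoothness 2
  exact ContDiff.mlieBracket_vectorField (m := ⊤) (n := ⊤) hV hW (by simp)

theorem SmoothVF.add {V W : ∀ x : M, TangentSpace (𝓡 4) x} (hV : SmoothVF V)
    (hW : SmoothVF W) : SmoothVF (V + W) :=
  ContMDiff.add_section hV hW

theorem SmoothVF.smul {f : M → ℝ} {V : ∀ x : M, TangentSpace (𝓡 4) x}
    (hf : ContMDiff (𝓡 4) 𝓘(ℝ, ℝ) ∞ f) (hV : SmoothVF V) : SmoothVF (f • V) :=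
  ContMDiff.smul_section hf hV

/-- The derivative of a real function along a vector field. -/
def dirDeriv (V : ∀ x : M, TangentSpace (𝓡 4) x) (f : M → ℝ) (x : M) : ℝ :=
  mfderiv (𝓡 4) 𝓘(ℝ, ℝ) f x (V x)

theorem contMDiff_mfderiv_apply {F : Type*} [NormedAddCommGroup F] [NormedSpace ℝ F] {f : M → F}
    (hf : ContMDiff (𝓡 4) 𝓘(ℝ, F) ∞ f) {V : ∀ x : M, TangentSpace (𝓡 4) x} (hV : SmoothVF V) :
    ContMDiff (𝓡 4) 𝓘(ℝ, F) ∞ (fun x => (mfderiv (𝓡 4) 𝓘(ℝ, F) f x (V x) : F)) :=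
  (contMDiff_snd_tangentBundle_modelSpace F 𝓘(ℝ, F)).comp
    ((hf.contMDiff_tangentMap (m := ∞) (by simp)).comp hV)

theorem contMDiff_dirDeriv {f : M → ℝ} (hf : ContMDiff (𝓡 4) 𝓘(ℝ, ℝ) ∞ f)
    {V : ∀ x : M, TangentSpace (𝓡 4) x} (hV : SmoothVF V) :
    ContMDiff (𝓡 4) 𝓘(ℝ, ℝ) ∞ (dirDeriv V f) :=
  contMDiff_mfderiv_apply hf hV

theorem mlieBracket_smul_right' {f : M → ℝ} (hf : ContMDiff (𝓡 4) 𝓘(ℝ, ℝ) ∞ f)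
    {V W : ∀ x : M, TangentSpace (𝓡 4) x} (hW : SmoothVF W) :
    VectorField.mlieBracket (𝓡 4) V (f • W) =
      dirDeriv V f • W + f • VectorField.mlieBracket (𝓡 4) V W := by
  have : IsManifold (𝓡 4) 2 M := isManifold_of_nat 2
  funext x
  exact VectorField.mlieBracket_smul_right ((hf x).mdifferentiableAt (by simp))
    (hW.mdifferentiableAt x)

theorem mlieBracket_add_right' {V W W' : ∀ x : M, TangentSpace (𝓡 4) x} (hW : SmoothVF W)
    (hW' : SmoothVF W') :
    VectorField.mlieBracket (𝓡 4) V (W + W') =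
      VectorField.mlieBracket (𝓡 4) V W + VectorField.mlieBracket (𝓡 4) V W' := by
  have : IsManifold (𝓡 4) 2 M := isManifold_of_nat 2
  funext x
  exact VectorField.mlieBracket_add_right (hW.mdifferentiableAt x) (hW'.mdifferentiableAt x)

theorem mlieBracket_jacobi {U V W : ∀ x : M, TangentSpace (𝓡 4) x} (hU : SmoothVF U)
    (hV : SmoothVF V) (hW : SmoothVF W) :
    VectorField.mlieBracket (𝓡 4) U (VectorField.mlieBracket (𝓡 4) V W) =
      VectorField.mlieBracket (𝓡 4) (VectorField.mlieBracket (𝓡 4) U V) W +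
        VectorField.mlieBracket (𝓡 4) V (VectorField.mlieBracket (𝓡 4) U W) := by
  have : IsManifold (𝓡 4) (minSmoothness ℝ 3) M :=
    isManifold_minSmoothness 3
  have h : minSmoothness ℝ 2 ≤ (∞ : ℕ∞ω) := by
    rw [minSmoothness_of_isRCLikeNormedField]; exact ofNat_le_infty 2
  exact VectorField.leibniz_identity_mlieBracket (hU.of_le h) (hV.of_le h) (hW.of_le h)

/-- `[V, W] f = V (W f) - W (V f)`, where `U` is any vector field without zeros.  It follows from
the Jacobi identity for `V`, `W` and `f U`. -/
theorem dirDeriv_mlieBracket {U V W : ∀ x : M, TangentSpace (𝓡 4) x} (hU : SmoothVF U)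
    (hV : SmoothVF V) (hW : SmoothVF W) (hU0 : ∀ x, U x ≠ 0) {f : M → ℝ}
    (hf : ContMDiff (𝓡 4) 𝓘(ℝ, ℝ) ∞ f) (x : M) :
    dirDeriv (VectorField.mlieBracket (𝓡 4) V W) f x =
      dirDeriv V (dirDeriv W f) x - dirDeriv W (dirDeriv V f) x := by
  have hJ := mlieBracket_jacobi hV hW (SmoothVF.smul hf hU)
  have hJ' := congrFun (mlieBracket_jacobi hV hW hU) x
  have hWf := contMDiff_dirDeriv hf hW
  have hVf := contMDiff_dirDeriv hf hV
  rw [mlieBracket_smul_right' hf hU, mlieBracket_smul_right' hf hU, mlieBracket_smul_right' hf hU,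
    mlieBracket_add_right' (SmoothVF.smul hWf hU) (SmoothVF.smul hf (hW.mlieBracket hU)),
    mlieBracket_add_right' (SmoothVF.smul hVf hU) (SmoothVF.smul hf (hV.mlieBracket hU)),
    mlieBracket_smul_right' hWf hU, mlieBracket_smul_right' hVf hU,
    mlieBracket_smul_right' hf (hW.mlieBracket hU),
    mlieBracket_smul_right' hf (hV.mlieBracket hU)] at hJ
  have hx := congrFun hJ x
  simp only [Pi.add_apply, Pi.smul_apply'] at hx hJ'
  rw [hJ', smul_add] at hx
  have h0 : (dirDeriv (VectorField.mlieBracket (𝓡 4) V W) f x -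
      (dirDeriv V (dirDeriv W f) x - dirDeriv W (dirDeriv V f) x)) • U x = 0 := by
    rw [sub_smul, sub_smul]
    linear_combination (norm := module) -hx
  exact sub_eq_zero.1 ((smul_eq_zero.1 h0).resolve_right (hU0 x))

end Fields
end

noncomputable section

namespace SpinSpacetime

variable {M : Type*} [TopologicalSpace M] [ChartedSpace (EuclideanSpace ℝ (Fin 4)) M]
  [IsManifold (𝓡 4) ∞ M]

theorem _root_.minkSign_mul_self (i : Fin 4) : minkSign i * minkSign i = 1 := by
  fin_cases i <;> simp [minkSign]

theorem g_sum_frame (S : SpinSpacetime M) (x : M) (a : Fin 4 → ℝ) (k : Fin 4) :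
    S.g x (∑ i, a i • S.e i x) (S.e k x) = minkSign k * a k := by
  simp [S.orthonormal, mul_comm]

theorem linearIndependent_frame (S : SpinSpacetime M) (x : M) :
    LinearIndependent ℝ (fun i => S.e i x) := by
  rw [Fintype.linearIndependent_iff]
  intro a ha k
  have h := S.g_sum_frame x a k
  rw [ha, map_zero, LinearMap.zero_apply] at h
  have := minkSign_mul_self k
  calc a k = minkSign k * minkSign k * a k := by rw [this, one_mul]
    _ = 0 := by rw [mul_assoc, ← h, mul_zero]

/-- The orthonormal frame as a basis of the tangent space. -/
def frameBasis (S : SpinSpacetime M) (x : M) : Module.Basis (Fin 4) ℝ (TangentSpace (𝓡 4) x) :=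
  haveI : FiniteDimensional ℝ (TangentSpace (𝓡 4) x) :=
    inferInstanceAs (FiniteDimensional ℝ (EuclideanSpace ℝ (Fin 4)))
  basisOfLinearIndependentOfCardEqFinrank (S.linearIndependent_frame x) (by
    have : Module.finrank ℝ (TangentSpace (𝓡 4) x) = 4 := finrank_euclideanSpace_fin (𝕜 := ℝ) (n := 4)
    rw [this]; rfl)

@[simp] theorem frameBasis_apply (S : SpinSpacetime M) (x : M) (i : Fin 4) :
    S.frameBasis x i = S.e i x := by
  simp [frameBasis]

theorem frameBasis_repr (S : SpinSpacetime M) (x : M) (v : TangentSpace (𝓡 4) x) (k : Fin 4) :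
    (S.frameBasis x).repr v k = minkSign k * S.g x v (S.e k x) := by
  have h := S.g_sum_frame x (fun i => (S.frameBasis x).repr v i) k
  have h2 := (S.frameBasis x).sum_repr v
  simp only [frameBasis_apply] at h2
  rw [h2] at h
  rw [h, ← mul_assoc, minkSign_mul_self, one_mul]

theorem sum_frame (S : SpinSpacetime M) (x : M) (v : TangentSpace (𝓡 4) x) :
    ∑ k, (minkSign k * S.g x v (S.e k x)) • S.e k x = v := by
  have h2 := (S.frameBasis x).sum_repr v
  simpa only [frameBasis_apply, frameBasis_repr] using h2

theorem frame_ne_zero (S : SpinSpacetime M) (i : Fin 4) (x : M) : S.e i x ≠ 0 := by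
  have := (S.frameBasis x).ne_zero i
  simpa using this

theorem smoothVF_frame (S : SpinSpacetime M) (i : Fin 4) : SmoothVF (S.e i) := S.smooth_e i

/-- The components of a smooth vector field in the frame are smooth. -/
theorem contMDiff_g_frame (S : SpinSpacetime M) {V : ∀ x : M, TangentSpace (𝓡 4) x}
    (hV : SmoothVF V) (k : Fin 4) :
    ContMDiff (𝓡 4) 𝓘(ℝ, ℝ) ∞ (fun x => S.g x (V x) (S.e k x)) := by
  intro x₀
  let E := EuclideanSpace ℝ (Fin 4)
  let t := trivializationAt E (TangentSpace (𝓡 4)) x₀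
  have hv : ContMDiffAt (𝓡 4) 𝓘(ℝ, E) ∞ (fun y => (t ⟨y, V y⟩).2) x₀ :=
    (Bundle.contMDiffAt_section x₀).1 (hV x₀)
  have he : ∀ i, ContMDiffAt (𝓡 4) 𝓘(ℝ, E) ∞ (fun y => (t ⟨y, S.e i y⟩).2) x₀ := fun i =>
    (Bundle.contMDiffAt_section x₀).1 (S.smooth_e i x₀)
  let L : M → ((Fin 4 → ℝ) →L[ℝ] E) := fun y =>
    ∑ i, (ContinuousLinearMap.proj (R := ℝ) (φ := fun _ : Fin 4 => ℝ) i).smulRight (t ⟨y, S.e i y⟩).2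
  have hL : ContMDiffAt (𝓡 4) 𝓘(ℝ, (Fin 4 → ℝ) →L[ℝ] E) ∞ L x₀ := by
    apply ContMDiffAt.sum
    intro i _
    exact ((ContinuousLinearMap.smulRightL ℝ (Fin 4 → ℝ) E
      (ContinuousLinearMap.proj (R := ℝ) (φ := fun _ : Fin 4 => ℝ) i)).contMDiff (n := ∞)).contMDiffAt.comp
        x₀ (he i)
  let Q : ∀ y ∈ t.baseSet, ((Fin 4 → ℝ) ≃L[ℝ] E) := fun y hy =>
    ((S.frameBasis y).equivFun.symm.trans (t.linearEquivAt ℝ y hy)).toContinuousLinearEquiv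
  have hQ : ∀ y (hy : y ∈ t.baseSet), (Q y hy : (Fin 4 → ℝ) →L[ℝ] E) = L y := by
    intro y hy
    ext1 a
    simp [Q, L, Module.Basis.equivFun_symm_apply]
  have hx₀ : x₀ ∈ t.baseSet := FiberBundle.mem_baseSet_trivializationAt' x₀
  have hinv : ContMDiffAt (𝓡 4) 𝓘(ℝ, E →L[ℝ] (Fin 4 → ℝ)) ∞
      (fun y => ContinuousLinearMap.inverse (L y)) x₀ := by
    have := contDiffAt_map_inverse (𝕜 := ℝ) (n := ∞) (Q x₀ hx₀)
    rw [hQ] at this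
    exact this.contMDiffAt.comp x₀ hL
  have hcoef := hinv.clm_apply hv
  have hk : ContMDiffAt (𝓡 4) 𝓘(ℝ, ℝ) ∞
      (fun y => minkSign k * (ContinuousLinearMap.inverse (L y) (t ⟨y, V y⟩).2) k) x₀ := by
    exact ((contMDiff_const (c := minkSign k)).contMDiffAt).mul
      (((ContinuousLinearMap.proj (R := ℝ) (φ := fun _ : Fin 4 => ℝ) k).contMDiff (n := ∞)).contMDiffAt.comp
        x₀ hcoef)
  refine hk.congr_of_eventuallyEq ?_
  filter_upwards [t.open_baseSet.mem_nhds hx₀] with y hy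
  have h1 : (t ⟨y, V y⟩).2 = Q y hy ((S.frameBasis y).equivFun (V y)) := by
    change _ = t.linearEquivAt ℝ y hy
      ((S.frameBasis y).equivFun.symm ((S.frameBasis y).equivFun (V y)))
    rw [LinearEquiv.symm_apply_apply]
    rfl
  rw [← hQ y hy, h1, ContinuousLinearMap.inverse_equiv]
  simp [frameBasis_repr, ← mul_assoc, minkSign_mul_self]

theorem contMDiff_structFn (S : SpinSpacetime M) (i j k : Fin 4) :
    ContMDiff (𝓡 4) 𝓘(ℝ, ℝ) ∞ (S.structFn i j k) :=
  S.contMDiff_g_frame ((S.smoothVF_frame i).mlieBracket (S.smoothVF_frame j)) k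

theorem mlieBracket_frame (S : SpinSpacetime M) (i j : Fin 4) :
    VectorField.mlieBracket (𝓡 4) (S.e i) (S.e j) =
      ∑ k, (fun x => minkSign k * S.structFn i j k x) • S.e k := by
  funext x
  rw [← S.sum_frame x (VectorField.mlieBracket (𝓡 4) (S.e i) (S.e j) x)]
  simp [Finset.sum_apply, structFn]

theorem dirDeriv_frame_comm (S : SpinSpacetime M) (i j : Fin 4) {f : M → ℝ}
    (hf : ContMDiff (𝓡 4) 𝓘(ℝ, ℝ) ∞ f) (x : M) :
    dirDeriv (S.e i) (dirDeriv (S.e j) f) x - dirDeriv (S.e j) (dirDeriv (S.e i) f) x =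
      ∑ k, minkSign k * S.structFn i j k x * dirDeriv (S.e k) f x := by
  rw [← dirDeriv_mlieBracket (S.smoothVF_frame 0) (S.smoothVF_frame i) (S.smoothVF_frame j)
    (S.frame_ne_zero 0) hf x, S.mlieBracket_frame]
  simp only [dirDeriv, Finset.sum_apply, Pi.smul_apply', map_sum, map_smul]
  rfl

/-- The components of `[e_i, V]` for a smooth vector field `V`. -/
theorem g_mlieBracket_frame (S : SpinSpacetime M) (i l : Fin 4) (V : ∀ x : M, TangentSpace (𝓡 4) x)
    (hV : SmoothVF V) (x : M) :
    S.g x (VectorField.mlieBracket (𝓡 4) (S.e i) V x) (S.e l x) =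
      dirDeriv (S.e i) (fun y => S.g y (V y) (S.e l y)) x +
        ∑ m, minkSign m * S.g x (V x) (S.e m x) * S.structFn i m l x := by
  have hc : ∀ m, ContMDiff (𝓡 4) 𝓘(ℝ, ℝ) ∞ (fun y => minkSign m * S.g y (V y) (S.e m y)) :=
    fun m => contMDiff_const.mul (S.contMDiff_g_frame hV m)
  have hVs : V = ∑ m, (fun y => minkSign m * S.g y (V y) (S.e m y)) • S.e m := by
    funext y
    conv_lhs => rw [← S.sum_frame y (V y)]
    simp [Finset.sum_apply]
  have hterm : ∀ m, SmoothVF ((fun y => minkSign m * S.g y (V y) (S.e m y)) • S.e m) :=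
    fun m => SmoothVF.smul (hc m) (S.smoothVF_frame m)
  have hsum : VectorField.mlieBracket (𝓡 4) (S.e i) V =
      ∑ m, VectorField.mlieBracket (𝓡 4) (S.e i)
        ((fun y => minkSign m * S.g y (V y) (S.e m y)) • S.e m) := by
    conv_lhs => rw [hVs]
    simp only [Fin.sum_univ_four]
    rw [mlieBracket_add_right' (((hterm 0).add (hterm 1)).add (hterm 2)) (hterm 3),
      mlieBracket_add_right' ((hterm 0).add (hterm 1)) (hterm 2),
      mlieBracket_add_right' (hterm 0) (hterm 1)]
  have hd : ∀ m, dirDeriv (S.e i) (fun y => minkSign m * S.g y (V y) (S.e m y)) x =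
      minkSign m * dirDeriv (S.e i) (fun y => S.g y (V y) (S.e m y)) x := by
    intro m
    have h := const_smul_mfderiv (I := 𝓡 4) (z := x) (s := minkSign m)
      (((S.contMDiff_g_frame hV m) x).mdifferentiableAt (by simp))
    exact congrArg (fun (φ : EuclideanSpace ℝ (Fin 4) →L[ℝ] ℝ) => φ (S.e i x)) h
  rw [hsum, Finset.sum_apply, map_sum, LinearMap.sum_apply]
  have hm : ∀ m, S.g x (VectorField.mlieBracket (𝓡 4) (S.e i)
        ((fun y => minkSign m * S.g y (V y) (S.e m y)) • S.e m) x) (S.e l x) =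
      minkSign m * dirDeriv (S.e i) (fun y => S.g y (V y) (S.e m y)) x *
        (if m = l then minkSign m else 0) +
      minkSign m * S.g x (V x) (S.e m x) * S.structFn i m l x := by
    intro m
    rw [mlieBracket_smul_right' (hc m) (S.smoothVF_frame m)]
    simp only [Pi.add_apply, Pi.smul_apply', map_add, map_smul, LinearMap.add_apply,
      LinearMap.smul_apply, smul_eq_mul, S.orthonormal, hd, structFn]
  simp only [hm, Finset.sum_add_distrib]
  congr 1
  rw [Finset.sum_eq_single l (fun m _ h => by simp [h]) (by simp)]
  rw [if_pos rfl]
  linear_combination dirDeriv (S.e i) (fun y => S.g y (V y) (S.e l y)) x * minkSign_mul_self l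

/-- The Jacobi identity for the structure functions. -/
theorem structFn_jacobi (S : SpinSpacetime M) (i j k l : Fin 4) (x : M) :
    dirDeriv (S.e i) (S.structFn j k l) x + dirDeriv (S.e j) (S.structFn k i l) x
      + dirDeriv (S.e k) (S.structFn i j l) x
      + ∑ m, minkSign m * (S.structFn j k m x * S.structFn i m l x
        + S.structFn k i m x * S.structFn j m l x + S.structFn i j m x * S.structFn k m l x) = 0 := by
  have hbr : ∀ a b, SmoothVF (VectorField.mlieBracket (𝓡 4) (S.e a) (S.e b)) := fun a b =>
    (S.smoothVF_frame a).mlieBracket (S.smoothVF_frame b)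
  have hJ := congrFun (mlieBracket_jacobi (S.smoothVF_frame i) (S.smoothVF_frame j)
    (S.smoothVF_frame k)) x
  rw [VectorField.mlieBracket_swap (W := S.e k) (V := VectorField.mlieBracket (𝓡 4) (S.e i) (S.e j)),
    Pi.add_apply, Pi.neg_apply] at hJ
  have hg := congrArg (fun v => S.g x v (S.e l x)) hJ
  simp only [map_add, map_neg, LinearMap.add_apply, LinearMap.neg_apply,
    S.g_mlieBracket_frame _ _ _ (hbr _ _)] at hg
  have hik : (fun y => S.g y (VectorField.mlieBracket (𝓡 4) (S.e i) (S.e k) y) (S.e l y)) =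
      fun y => -S.structFn k i l y := by
    funext y; exact S.structFn_antisymm i k l y
  have hd : dirDeriv (S.e j) (fun y => -S.structFn k i l y) x =
      -dirDeriv (S.e j) (S.structFn k i l) x := by
    have h := mfderiv_neg (I := 𝓡 4) (f := S.structFn k i l) (x := x)
    exact congrArg (fun (φ : EuclideanSpace ℝ (Fin 4) →L[ℝ] ℝ) => φ (S.e j x)) h
  rw [hik, hd] at hg
  have hm : ∀ m, S.g x (VectorField.mlieBracket (𝓡 4) (S.e i) (S.e k) x) (S.e m x) =
      -S.structFn k i m x := fun m => S.structFn_antisymm i k m x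
  have hs : ∀ a b m, S.g x (VectorField.mlieBracket (𝓡 4) (S.e a) (S.e b) x) (S.e m x) =
      S.structFn a b m x := fun _ _ _ => rfl
  have hf : ∀ a b, (fun y => S.g y (VectorField.mlieBracket (𝓡 4) (S.e a) (S.e b) y) (S.e l y)) =
      S.structFn a b l := fun _ _ => rfl
  simp only [hm, hs, hf] at hg
  simp only [Fin.sum_univ_four] at hg ⊢
  linear_combination hg

end SpinSpacetime
end

noncomputable section

section SmoothFunctions

variable (M : Type*) [TopologicalSpace M] [ChartedSpace (EuclideanSpace ℝ (Fin 4)) M]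

/-- The algebra of smooth complex functions. -/
def smoothFn : Subalgebra ℂ (M → ℂ) where
  carrier := {f | ContMDiff (𝓡 4) 𝓘(ℝ, ℂ) ∞ f}
  mul_mem' {f g} hf hg := by
    have : ContDiff ℝ ∞ (fun p : ℂ × ℂ => p.1 * p.2) := contDiff_fst.mul contDiff_snd
    exact this.contMDiff.comp (ContMDiff.prodMk_space hf hg)
  add_mem' hf hg := ContMDiff.add hf hg
  algebraMap_mem' c := contMDiff_const

end SmoothFunctions

variable {M : Type*} [TopologicalSpace M] [ChartedSpace (EuclideanSpace ℝ (Fin 4)) M]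

theorem smoothFn.mdifferentiableAt (f : smoothFn M) (x : M) :
    MDifferentiableAt (𝓡 4) 𝓘(ℝ, ℂ) (f : M → ℂ) x := (f.2 x).mdifferentiableAt (by simp)

/-- Evaluation at a point. -/
def smoothFn.eval (x : M) : smoothFn M →ₐ[ℂ] ℂ :=
  (Pi.evalAlgHom ℂ (fun _ : M => ℂ) x).comp (smoothFn M).val

theorem smoothFn.eval_apply (x : M) (f : smoothFn M) : smoothFn.eval x f = (f : M → ℂ) x := rfl

theorem smoothFn.ext_eval {f g : smoothFn M} (h : ∀ x, smoothFn.eval x f = smoothFn.eval x g) :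
    f = g := Subtype.ext (funext h)

/-- Complex conjugation of smooth functions. -/
def smoothFn.conj : smoothFn M →+* smoothFn M where
  toFun f := ⟨fun x => starRingEnd ℂ ((f : M → ℂ) x),
    (Complex.conjCLE.contDiff (n := ∞)).contMDiff.comp f.2⟩
  map_one' := by ext x; simp
  map_mul' f g := by ext x; simp
  map_zero' := by ext x; simp
  map_add' f g := by ext x; simp

theorem smoothFn.eval_conj (x : M) (f : smoothFn M) :
    smoothFn.eval x (smoothFn.conj f) = starRingEnd ℂ (smoothFn.eval x f) := rfl

theorem smoothFn.conj_conj (f : smoothFn M) : smoothFn.conj (smoothFn.conj f) = f := by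
  ext x; simp [smoothFn.conj]

theorem smoothFn.conj_smul (c : ℂ) (f : smoothFn M) :
    smoothFn.conj (c • f) = starRingEnd ℂ c • smoothFn.conj f := by
  ext x; simp [smoothFn.conj]

/-- A smooth real function as a smooth complex function. -/
def smoothFn.ofReal (f : M → ℝ) (hf : ContMDiff (𝓡 4) 𝓘(ℝ, ℝ) ∞ f) : smoothFn M :=
  ⟨fun x => (f x : ℂ), (Complex.ofRealCLM.contDiff (n := ∞)).contMDiff.comp hf⟩

theorem smoothFn.eval_ofReal (x : M) (f : M → ℝ) (hf) :
    smoothFn.eval x (smoothFn.ofReal f hf) = (f x : ℂ) := rfl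

namespace SpinSpacetime

variable [IsManifold (𝓡 4) ∞ M]

theorem D_comp_clm (S : SpinSpacetime M) {F : Type*} [NormedAddCommGroup F] [NormedSpace ℝ F]
    (L : F →L[ℝ] ℂ) {f : M → F} (hf : ContMDiff (𝓡 4) 𝓘(ℝ, F) ∞ f) (k : Fin 4) (x : M) :
    S.D k (fun y => L (f y)) x = L (mfderiv (𝓡 4) 𝓘(ℝ, F) f x (S.e k x)) := by
  have h := (L.hasMFDerivAt (x := f x)).comp x ((hf x).mdifferentiableAt (by simp)).hasMFDerivAt
  have h2 := h.mfderiv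
  exact congrArg (fun (φ : EuclideanSpace ℝ (Fin 4) →L[ℝ] ℂ) => φ (S.e k x)) h2

theorem D_ofReal (S : SpinSpacetime M) (k : Fin 4) {f : M → ℝ}
    (hf : ContMDiff (𝓡 4) 𝓘(ℝ, ℝ) ∞ f) (x : M) :
    S.D k (fun y => (f y : ℂ)) x = (dirDeriv (S.e k) f x : ℂ) :=
  S.D_comp_clm Complex.ofRealCLM hf k x

/-- The derivation `e_k` of the algebra of smooth functions. -/
def dR (S : SpinSpacetime M) (k : Fin 4) : Derivation ℂ (smoothFn M) (smoothFn M) :=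
  Derivation.mk'
    { toFun := fun f => ⟨S.D k f, contMDiff_mfderiv_apply f.2 (S.smoothVF_frame k)⟩
      map_add' := fun f g => by
        ext x
        have h := mfderiv_add (smoothFn.mdifferentiableAt f x) (smoothFn.mdifferentiableAt g x)
        exact congrArg (fun (φ : EuclideanSpace ℝ (Fin 4) →L[ℝ] ℂ) => φ (S.e k x)) h
      map_smul' := fun c f => by
        ext x
        exact S.D_comp_clm (ContinuousLinearMap.mul ℝ ℂ c) f.2 k x }
    (fun f g => by
      ext x
      have h := (smoothFn.mdifferentiableAt f x).hasMFDerivAt.mul (smoothFn.mdifferentiableAt g x).hasMFDerivAt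
      have h2 := h.mfderiv
      have h3 := congrArg (fun (φ : EuclideanSpace ℝ (Fin 4) →L[ℝ] ℂ) => φ (S.e k x)) h2
      exact h3)

theorem eval_dR (S : SpinSpacetime M) (k : Fin 4) (f : smoothFn M) (x : M) :
    smoothFn.eval x (S.dR k f) = S.D k f x := rfl

theorem dR_conj (S : SpinSpacetime M) (k : Fin 4) (f : smoothFn M) :
    S.dR k (smoothFn.conj f) = smoothFn.conj (S.dR k f) := by
  ext x
  exact S.D_comp_clm (Complex.conjCLE : ℂ →L[ℝ] ℂ) f.2 k x

/-- The structure functions `c_{ij}{}^k` as smooth functions. -/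
def cR (S : SpinSpacetime M) (i j k : Fin 4) : smoothFn M :=
  (minkSign k : ℂ) • smoothFn.ofReal (S.structFn i j k) (S.contMDiff_structFn i j k)

theorem dR_ofReal (S : SpinSpacetime M) (k : Fin 4) (f : M → ℝ) (hf) (x : M) :
    smoothFn.eval x (S.dR k (smoothFn.ofReal f hf)) = (dirDeriv (S.e k) f x : ℂ) :=
  S.D_ofReal k hf x

theorem dR_comm_ofReal (S : SpinSpacetime M) (i j : Fin 4) (f : M → ℝ) (hf) :
    S.dR i (S.dR j (smoothFn.ofReal f hf)) - S.dR j (S.dR i (smoothFn.ofReal f hf)) =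
      ∑ k, S.cR i j k * S.dR k (smoothFn.ofReal f hf) := by
  have hd : ∀ k, S.dR k (smoothFn.ofReal f hf) =
      smoothFn.ofReal (dirDeriv (S.e k) f) (contMDiff_dirDeriv hf (S.smoothVF_frame k)) := fun k =>
    smoothFn.ext_eval fun x => S.dR_ofReal k f hf x
  simp only [hd]
  refine smoothFn.ext_eval fun x => ?_
  have h := S.dirDeriv_frame_comm i j hf x
  simp only [map_sub, map_sum, map_mul, dR_ofReal, cR, map_smul, smoothFn.eval_ofReal, smul_eq_mul]
  exact_mod_cast h

theorem dR_comm (S : SpinSpacetime M) (i j : Fin 4) (f : smoothFn M) :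
    S.dR i (S.dR j f) - S.dR j (S.dR i f) = ∑ k, S.cR i j k * S.dR k f := by
  have hre : ContMDiff (𝓡 4) 𝓘(ℝ, ℝ) ∞ (fun x => ((f : M → ℂ) x).re) :=
    (Complex.reCLM.contDiff (n := ∞)).contMDiff.comp f.2
  have him : ContMDiff (𝓡 4) 𝓘(ℝ, ℝ) ∞ (fun x => ((f : M → ℂ) x).im) :=
    (Complex.imCLM.contDiff (n := ∞)).contMDiff.comp f.2
  have hf : f = smoothFn.ofReal _ hre + Complex.I • smoothFn.ofReal _ him := by
    ext x
    change (f : M → ℂ) x = (((f : M → ℂ) x).re : ℂ) + Complex.I * (((f : M → ℂ) x).im : ℂ)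
    rw [mul_comm, Complex.re_add_im]
  have h1 := S.dR_comm_ofReal i j _ hre
  have h2 := S.dR_comm_ofReal i j _ him
  rw [hf]
  simp only [map_add, Derivation.map_smul, mul_add, Finset.sum_add_distrib, mul_smul_comm,
    ← Finset.smul_sum]
  rw [← h1, ← h2, smul_sub]
  ring

theorem cR_jacobi (S : SpinSpacetime M) (i j k l : Fin 4) :
    (S.dR i (S.cR j k l) + ∑ m, S.cR j k m * S.cR i m l)
      + (S.dR j (S.cR k i l) + ∑ m, S.cR k i m * S.cR j m l)
      + (S.dR k (S.cR i j l) + ∑ m, S.cR i j m * S.cR k m l) = 0 := by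
  refine smoothFn.ext_eval fun x => ?_
  have h := S.structFn_jacobi i j k l x
  have h' := congrArg (fun r : ℝ => ((minkSign l * r : ℝ) : ℂ)) h
  simp only [map_add, map_sum, map_mul, dR_ofReal, cR, map_smul, Derivation.map_smul,
    smoothFn.eval_ofReal, smul_eq_mul, map_zero]
  simp only [Fin.sum_univ_four] at h' ⊢
  push_cast at h'
  linear_combination h'

theorem contMDiff_leviCivita (S : SpinSpacetime M) (k i j : Fin 4) :
    ContMDiff (𝓡 4) 𝓘(ℝ, ℝ) ∞ (S.leviCivita k i j) := by
  have h := ((S.contMDiff_structFn k i j).sub (S.contMDiff_structFn i j k)).add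
    (S.contMDiff_structFn j k i)
  have h2 := (contMDiff_const (c := (2⁻¹ : ℝ)) (I := 𝓡 4) (M := M) (n := ∞)).mul h
  refine h2.congr fun x => ?_
  simp only [leviCivita, Pi.mul_apply, Pi.add_apply]
  ring

/-- The spin connection as smooth functions. -/
def omR (S : SpinSpacetime M) (k : Fin 4) (B C : Fin 2) : smoothFn M :=
  ∑ D, spinEps C D • ((1 / 2 : ℂ) • ∑ B', ∑ C', spinEps B' C' • ∑ i, ∑ j,
    (ivdW i B B' * ivdW j D C') • smoothFn.ofReal (S.leviCivita k i j) (S.contMDiff_leviCivita k i j))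

theorem eval_omR (S : SpinSpacetime M) (k : Fin 4) (B C : Fin 2) (x : M) :
    smoothFn.eval x (S.omR k B C) = S.spinConn k B C x := by
  simp only [omR, map_sum, map_smul, smul_eq_mul, smoothFn.eval_ofReal, spinConn, spinConnLow]

theorem omR_coe (S : SpinSpacetime M) (k : Fin 4) (B C : Fin 2) :
    (S.omR k B C : M → ℂ) = S.spinConn k B C := funext fun x => S.eval_omR k B C x

end SpinSpacetime
end

noncomputable section

/-- The spinor form `½ ε^{CD} ε^{B'D'} G_{BB' DD'}` of a real antisymmetric matrix `G`. -/
def spinPart (G : Fin 4 → Fin 4 → ℝ) (B C : Fin 2) : ℂ :=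
  ∑ D, spinEps C D * ((1 / 2) * ∑ B', ∑ C', spinEps B' C' *
    ∑ i, ∑ j, ivdW i B B' * ivdW j D C' * (G i j : ℂ))

theorem ivdW_mul_ivdW (i j : Fin 4) (A A' B B' : Fin 2) :
    ivdW i A A' * ivdW j B B' = pauli i A A' * pauli j B B' / 2 := by
  have h : ((√2 : ℝ) : ℂ) * ((√2 : ℝ) : ℂ) = 2 := by
    rw [← Complex.ofReal_mul, Real.mul_self_sqrt (by norm_num)]; norm_num
  rw [ivdW, ivdW, div_mul_div_comm, h]

theorem spinPart_eq (G : Fin 4 → Fin 4 → ℝ) (hG : ∀ i j, G i j = -G j i) :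
    (spinPart G 0 0 = (-G 0 3 - Complex.I * G 1 2) / 2 ∧
    spinPart G 0 1 = (-G 0 1 + Complex.I * G 0 2 + G 1 3 - Complex.I * G 2 3) / 2) ∧
    (spinPart G 1 0 = (-G 0 1 - Complex.I * G 0 2 - G 1 3 - Complex.I * G 2 3) / 2 ∧
    spinPart G 1 1 = (G 0 3 + Complex.I * G 1 2) / 2) := by
  have h (i : Fin 4) : G i i = 0 := by linarith [hG i i]
  refine ⟨⟨?_, ?_⟩, ?_, ?_⟩ <;>
  · simp only [spinPart, ivdW_mul_ivdW, Fin.sum_univ_two, Fin.sum_univ_four]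
    simp [spinEps, pauli, h, hG 1 0, hG 2 0, hG 3 0, hG 2 1, hG 3 1, hG 3 2]
    ring

/-- The action of a real antisymmetric matrix on vectors in terms of its action on spinors. -/
theorem ivdW_mul_antisymm (G : Fin 4 → Fin 4 → ℝ) (hG : ∀ i j, G i j = -G j i) (B B' : Fin 2)
    (k : Fin 4) :
    ∑ j, ivdW j B B' * (minkSign k * G j k : ℂ) =
      ∑ C, ivdW k C B' * spinPart G B C + ∑ C', ivdW k B C' * conj (spinPart G B' C') := by
  have h (i : Fin 4) : G i i = 0 := by linarith [hG i i]
  obtain ⟨⟨h00, h01⟩, h10, h11⟩ := spinPart_eq G hG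
  fin_cases B <;> fin_cases B' <;> fin_cases k <;>
  · simp [Fin.sum_univ_four, h00, h01, h10, h11, ivdW, pauli, minkSign, h, Complex.conj_ofNat,
      hG 1 0, hG 2 0, hG 3 0, hG 2 1, hG 3 1, hG 3 2]
    ring_nf
    try simp only [Complex.I_sq]
    try ring_nf

theorem conj_ivdW (i : Fin 4) (A A' : Fin 2) : conj (ivdW i A A') = ivdW i A' A := by
  fin_cases i <;> fin_cases A <;> fin_cases A' <;> simp [ivdW, pauli]

theorem ivdW_complete (C C' D D' : Fin 2) :
    ∑ k, ivdW k D' D * ivdW k C C' = if C = D ∧ C' = D' then 1 else 0 := by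
  simp only [ivdW_mul_ivdW]
  fin_cases C <;> fin_cases C' <;> fin_cases D <;> fin_cases D' <;>
    simp [Fin.sum_univ_four, pauli] <;> norm_num

theorem ivdW_injective {R : Type*} [AddCommGroup R] [Module ℂ R] (X : Fin 2 → Fin 2 → R)
    (h : ∀ k, ∑ C, ∑ C', ivdW k C C' • X C C' = 0) (D D' : Fin 2) : X D D' = 0 := by
  have h1 : ∑ k, ivdW k D' D • ∑ C, ∑ C', ivdW k C C' • X C C' = 0 := by
    simp only [h, smul_zero, Finset.sum_const_zero]
  simp only [Finset.smul_sum, smul_smul] at h1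
  rw [Finset.sum_comm] at h1
  simp_rw [Finset.sum_comm (s := (Finset.univ : Finset (Fin 4))), ← Finset.sum_smul,
    ivdW_complete] at h1
  simpa [ite_and] using h1

/-- The structure functions `c_{ab}{}^c` of the spin basis in terms of the spin connection. -/
def nullStruct {R : Type*} [CommRing R] (w v : Fin 2 → Fin 2 → Fin 2 → Fin 2 → R)
    (A A' B B' C C' : Fin 2) : R :=
  w A A' B C * (if B' = C' then 1 else 0) + (if B = C then 1 else 0) * v A A' B' C'
    - (w B B' A C * (if A' = C' then 1 else 0) + (if A = C then 1 else 0) * v B B' A' C')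

namespace SpinSpacetime

variable {M : Type*} [TopologicalSpace M] [ChartedSpace (EuclideanSpace ℝ (Fin 4)) M]
  [IsManifold (𝓡 4) ∞ M]

/-- The derivations `e_{AA'}`. -/
def eN (S : SpinSpacetime M) (A A' : Fin 2) : Derivation ℂ (smoothFn M) (smoothFn M) :=
  ∑ i, ivdW i A A' • S.dR i

/-- The spin connection `ω_{AA' B}{}^C`. -/
def wN (S : SpinSpacetime M) (A A' B C : Fin 2) : smoothFn M := ∑ i, ivdW i A A' • S.omR i B C

/-- The spin connection `ω̄_{AA' B'}{}^{C'}` on primed spinors. -/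
def vN (S : SpinSpacetime M) (A A' B C : Fin 2) : smoothFn M :=
  ∑ i, ivdW i A A' • smoothFn.conj (S.omR i B C)

theorem eN_apply (S : SpinSpacetime M) (A A' : Fin 2) (f : smoothFn M) :
    S.eN A A' f = ∑ i, ivdW i A A' • S.dR i f := by
  simp [eN, Fin.sum_univ_four]

theorem conj_eN (S : SpinSpacetime M) (A A' : Fin 2) (f : smoothFn M) :
    smoothFn.conj (S.eN A A' f) = S.eN A' A (smoothFn.conj f) := by
  simp [eN_apply, smoothFn.conj_smul, conj_ivdW, dR_conj]

theorem conj_wN (S : SpinSpacetime M) (A A' B C : Fin 2) :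
    smoothFn.conj (S.wN A A' B C) = S.vN A' A B C := by
  simp [wN, vN, smoothFn.conj_smul, conj_ivdW]

theorem omR_trace (S : SpinSpacetime M) (k : Fin 4) : S.omR k 1 1 = -S.omR k 0 0 := by
  refine smoothFn.ext_eval fun x => ?_
  rw [map_neg, eval_omR, eval_omR]
  obtain ⟨⟨h00, -⟩, -, h11⟩ := spinPart_eq (fun i j => S.leviCivita k i j x)
    (fun i j => S.leviCivita_metric k i j x)
  change spinPart (fun i j => S.leviCivita k i j x) 1 1 =
    -spinPart (fun i j => S.leviCivita k i j x) 0 0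
  rw [h00, h11]; ring

theorem wN_trace (S : SpinSpacetime M) (A A' : Fin 2) : S.wN A A' 1 1 = -S.wN A A' 0 0 := by
  simp [wN, omR_trace]

theorem vN_trace (S : SpinSpacetime M) (A A' : Fin 2) : S.vN A A' 1 1 = -S.vN A A' 0 0 := by
  simp [vN, omR_trace]

/-- `Γ_{kj}{}^l` as smooth functions. -/
def gamR (S : SpinSpacetime M) (k j l : Fin 4) : smoothFn M :=
  (minkSign l : ℂ) • smoothFn.ofReal (S.leviCivita k j l) (S.contMDiff_leviCivita k j l)

theorem cR_eq (S : SpinSpacetime M) (i j k : Fin 4) :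
    S.cR i j k = S.gamR i j k - S.gamR j i k := by
  refine smoothFn.ext_eval fun x => ?_
  simp only [cR, gamR, map_sub, map_smul, smoothFn.eval_ofReal, smul_eq_mul,
    ← S.leviCivita_torsion i j k x]
  push_cast; ring

theorem sum_ivdW_gamR (S : SpinSpacetime M) (i k : Fin 4) (B B' : Fin 2) :
    ∑ j, ivdW j B B' • S.gamR i j k =
      ∑ C, ivdW k C B' • S.omR i B C + ∑ C', ivdW k B C' • smoothFn.conj (S.omR i B' C') := by
  refine smoothFn.ext_eval fun x => ?_
  simp only [map_add, map_sum, map_smul, smoothFn.eval_conj, eval_omR, gamR, smoothFn.eval_ofReal,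
    smul_eq_mul]
  exact ivdW_mul_antisymm (fun a b => S.leviCivita i a b x)
    (fun a b => S.leviCivita_metric i a b x) B B' k

theorem sum_ivdW_ivdW_gamR (S : SpinSpacetime M) (k : Fin 4) (A A' B B' : Fin 2) :
    ∑ i, ∑ j, (ivdW i A A' * ivdW j B B') • S.gamR i j k =
      ∑ C, ivdW k C B' • S.wN A A' B C + ∑ C', ivdW k B C' • S.vN A A' B' C' := by
  simp only [mul_smul, ← Finset.smul_sum, sum_ivdW_gamR, wN, vN]
  simp only [Finset.smul_sum, smul_add, Finset.sum_add_distrib]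
  congr 1 <;>
  · rw [Finset.sum_comm]
    exact Finset.sum_congr rfl fun _ _ => Finset.sum_congr rfl fun _ _ => smul_comm _ _ _

theorem sum_ivdW_cR (S : SpinSpacetime M) (k : Fin 4) (A A' B B' : Fin 2) :
    ∑ i, ∑ j, (ivdW i A A' * ivdW j B B') • S.cR i j k =
      ∑ C, ∑ C', ivdW k C C' • nullStruct S.wN S.vN A A' B B' C C' := by
  have h1 := S.sum_ivdW_ivdW_gamR k A A' B B'
  have h2 := S.sum_ivdW_ivdW_gamR k B B' A A'
  rw [Finset.sum_comm] at h2
  simp only [cR_eq, smul_sub, Finset.sum_sub_distrib]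
  rw [h1]
  simp only [mul_comm (ivdW _ B B')] at h2
  rw [h2]
  simp only [nullStruct, smul_add, smul_sub, Finset.sum_add_distrib, Finset.sum_sub_distrib]
  simp

end SpinSpacetime
end

noncomputable section

/-- The algebraic content of a spin basis: derivations `e_{AA'}` and trace-free connection
coefficients `ω_{AA' B}{}^C`, `ω̄_{AA' B'}{}^{C'}` of a torsion-free connection. -/
structure NullFrame (R : Type*) [CommRing R] [Algebra ℂ R] where
  e : Fin 2 → Fin 2 → Derivation ℂ R R
  w : Fin 2 → Fin 2 → Fin 2 → Fin 2 → R
  v : Fin 2 → Fin 2 → Fin 2 → Fin 2 → R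
  w_trace : ∀ A A', w A A' 1 1 = -w A A' 0 0
  v_trace : ∀ A A', v A A' 1 1 = -v A A' 0 0
  comm : ∀ A A' B B' f, e A A' (e B B' f) - e B B' (e A A' f) =
    ∑ C, ∑ C', nullStruct w v A A' B B' C C' * e C C' f
  jacobi : ∀ A A' B B' C C' D D',
    (e A A' (nullStruct w v B B' C C' D D') +
      ∑ F, ∑ F', nullStruct w v B B' C C' F F' * nullStruct w v A A' F F' D D')
    + (e B B' (nullStruct w v C C' A A' D D') +
      ∑ F, ∑ F', nullStruct w v C C' A A' F F' * nullStruct w v B B' F F' D D')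
    + (e C C' (nullStruct w v A A' B B' D D') +
      ∑ F, ∑ F', nullStruct w v A A' B B' F F' * nullStruct w v C C' F F' D D') = 0

/-- The curvature `F_{AA' BB' C}{}^D` of the connection coefficients `u`. -/
def NullFrame.curv {R : Type*} [CommRing R] [Algebra ℂ R] (N : NullFrame R)
    (u : Fin 2 → Fin 2 → Fin 2 → Fin 2 → R) (A A' B B' C D : Fin 2) : R :=
  N.e A A' (u B B' C D) - N.e B B' (u A A' C D)
    + ∑ F, (u B B' C F * u A A' F D - u A A' C F * u B B' F D)
    - ∑ F, ∑ F', nullStruct N.w N.v A A' B B' F F' * u F F' C D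

section Sums

variable {α β γ δ R : Type*} [Fintype α] [Fintype β] [Fintype γ] [Fintype δ] [AddCommMonoid R]

theorem sum_rotate (f : α → β → γ → R) :
    ∑ i, ∑ j, ∑ k, f i j k = ∑ j, ∑ k, ∑ i, f i j k := by
  rw [Finset.sum_comm]
  exact Finset.sum_congr rfl fun _ _ => Finset.sum_comm

theorem sum_comm_pairs (f : α → β → γ → δ → R) :
    ∑ i, ∑ j, ∑ k, ∑ l, f i j k l = ∑ k, ∑ l, ∑ i, ∑ j, f i j k l := by
  rw [Finset.sum_congr rfl fun _ _ => sum_rotate _]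
  rw [sum_rotate]

end Sums

namespace SpinSpacetime

variable {M : Type*} [TopologicalSpace M] [ChartedSpace (EuclideanSpace ℝ (Fin 4)) M]
  [IsManifold (𝓡 4) ∞ M]

theorem eN_eN (S : SpinSpacetime M) (A A' B B' : Fin 2) (f : smoothFn M) :
    S.eN A A' (S.eN B B' f) =
      ∑ i, ∑ j, (ivdW i A A' * ivdW j B B') • S.dR i (S.dR j f) := by
  rw [eN_apply S B B', map_sum, Finset.sum_comm]
  refine Finset.sum_congr rfl fun j _ => ?_
  simp only [eN_apply, Derivation.map_smul, Finset.smul_sum, smul_smul, mul_comm]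

theorem sum_nullStruct_mul (S : SpinSpacetime M) (A A' B B' : Fin 2) (u : Fin 4 → smoothFn M) :
    ∑ C, ∑ C', nullStruct S.wN S.vN A A' B B' C C' * ∑ k, ivdW k C C' • u k =
      ∑ i, ∑ j, (ivdW i A A' * ivdW j B B') • ∑ k, S.cR i j k * u k := by
  have h3 : ∑ k, (∑ i, ∑ j, (ivdW i A A' * ivdW j B B') • S.cR i j k) * u k =
      ∑ C, ∑ C', nullStruct S.wN S.vN A A' B B' C C' * ∑ k, ivdW k C C' • u k := by
    simp only [sum_ivdW_cR, Finset.sum_mul, Finset.mul_sum, smul_mul_assoc, mul_smul_comm]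
    rw [sum_rotate]
  rw [← h3]
  simp only [Finset.sum_mul, smul_mul_assoc, Finset.smul_sum]
  rw [sum_rotate]

theorem eN_comm (S : SpinSpacetime M) (A A' B B' : Fin 2) (f : smoothFn M) :
    S.eN A A' (S.eN B B' f) - S.eN B B' (S.eN A A' f) =
      ∑ C, ∑ C', nullStruct S.wN S.vN A A' B B' C C' * S.eN C C' f := by
  have h2 : S.eN B B' (S.eN A A' f) =
      ∑ i, ∑ j, (ivdW i A A' * ivdW j B B') • S.dR j (S.dR i f) := by
    rw [eN_eN, Finset.sum_comm]
    simp only [mul_comm (ivdW _ B B')]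
  rw [eN_eN, h2]
  simp only [eN_apply, sum_nullStruct_mul]
  simp only [← Finset.sum_sub_distrib, ← smul_sub, dR_comm]

/-- One third of the Jacobi identity in the spin basis. -/
theorem sum_ivdW_jacobi_term (S : SpinSpacetime M) (A A' B B' C C' : Fin 2) (l : Fin 4) :
    ∑ D, ∑ D', ivdW l D D' • (S.eN A A' (nullStruct S.wN S.vN B B' C C' D D') +
      ∑ F, ∑ F', nullStruct S.wN S.vN B B' C C' F F' * nullStruct S.wN S.vN A A' F F' D D') =
    ∑ i, ∑ j, ∑ k, (ivdW i A A' * ivdW j B B' * ivdW k C C') •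
      (S.dR i (S.cR j k l) + ∑ m, S.cR j k m * S.cR i m l) := by
  have hT : ∑ D, ∑ D', ivdW l D D' • S.eN A A' (nullStruct S.wN S.vN B B' C C' D D') =
      ∑ i, ∑ j, ∑ k, (ivdW i A A' * ivdW j B B' * ivdW k C C') • S.dR i (S.cR j k l) := by
    have h := congrArg (S.eN A A') (S.sum_ivdW_cR l B B' C C')
    simp only [map_sum, Derivation.map_smul] at h
    rw [← h, sum_rotate]
    simp only [eN_apply, Finset.smul_sum, smul_smul, mul_assoc]
    simp only [mul_comm, mul_left_comm]
  have hU : ∑ D, ∑ D', ivdW l D D' •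
      ∑ F, ∑ F', nullStruct S.wN S.vN B B' C C' F F' * nullStruct S.wN S.vN A A' F F' D D' =
      ∑ i, ∑ j, ∑ k, (ivdW i A A' * ivdW j B B' * ivdW k C C') •
        ∑ m, S.cR j k m * S.cR i m l := by
    have h1 : ∑ D, ∑ D', ivdW l D D' •
        ∑ F, ∑ F', nullStruct S.wN S.vN B B' C C' F F' * nullStruct S.wN S.vN A A' F F' D D' =
        ∑ F, ∑ F', nullStruct S.wN S.vN B B' C C' F F' *
          ∑ D, ∑ D', ivdW l D D' • nullStruct S.wN S.vN A A' F F' D D' := by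
      simp only [Finset.smul_sum, Finset.mul_sum, mul_smul_comm]
      rw [sum_comm_pairs]
    have h2 : ∀ F F', ∑ D, ∑ D', ivdW l D D' • nullStruct S.wN S.vN A A' F F' D D' =
        ∑ m, ivdW m F F' • ∑ i, ivdW i A A' • S.cR i m l := by
      intro F F'
      rw [← sum_ivdW_cR, Finset.sum_comm]
      simp only [Finset.smul_sum, smul_smul, mul_comm]
    rw [h1]
    simp only [h2, sum_nullStruct_mul]
    rw [sum_rotate]
    simp only [Finset.mul_sum, Finset.smul_sum, smul_smul, mul_smul_comm]
    refine Finset.sum_congr rfl fun j _ => Finset.sum_congr rfl fun k _ => ?_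
    rw [Finset.sum_comm]
    simp only [mul_comm, mul_left_comm]
  simp only [smul_add, Finset.sum_add_distrib, hT, hU]

theorem nullStruct_jacobi (S : SpinSpacetime M) (A A' B B' C C' D D' : Fin 2) :
    (S.eN A A' (nullStruct S.wN S.vN B B' C C' D D') +
      ∑ F, ∑ F', nullStruct S.wN S.vN B B' C C' F F' * nullStruct S.wN S.vN A A' F F' D D')
    + (S.eN B B' (nullStruct S.wN S.vN C C' A A' D D') +
      ∑ F, ∑ F', nullStruct S.wN S.vN C C' A A' F F' * nullStruct S.wN S.vN B B' F F' D D')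
    + (S.eN C C' (nullStruct S.wN S.vN A A' B B' D D') +
      ∑ F, ∑ F', nullStruct S.wN S.vN A A' B B' F F' * nullStruct S.wN S.vN C C' F F' D D')
    = 0 := by
  refine ivdW_injective (fun D D' =>
    (S.eN A A' (nullStruct S.wN S.vN B B' C C' D D') +
      ∑ F, ∑ F', nullStruct S.wN S.vN B B' C C' F F' * nullStruct S.wN S.vN A A' F F' D D')
    + (S.eN B B' (nullStruct S.wN S.vN C C' A A' D D') +
      ∑ F, ∑ F', nullStruct S.wN S.vN C C' A A' F F' * nullStruct S.wN S.vN B B' F F' D D')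
    + (S.eN C C' (nullStruct S.wN S.vN A A' B B' D D') +
      ∑ F, ∑ F', nullStruct S.wN S.vN A A' B B' F F' * nullStruct S.wN S.vN C C' F F' D D'))
    (fun l => ?_) D D'
  simp only [smul_add (_ : ℂ) (_ + _) (_ + _), Finset.sum_add_distrib]
  have h1 := S.sum_ivdW_jacobi_term A A' B B' C C' l
  have h2 := S.sum_ivdW_jacobi_term B B' C C' A A' l
  have h3 := S.sum_ivdW_jacobi_term C C' A A' B B' l
  rw [← sum_rotate] at h2
  rw [sum_rotate] at h3
  simp only [smul_add, Finset.sum_add_distrib] at h1 h2 h3 ⊢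
  rw [h1, h2, h3]
  simp only [← Finset.sum_add_distrib]
  refine Finset.sum_eq_zero fun i _ => Finset.sum_eq_zero fun j _ => Finset.sum_eq_zero fun k _ => ?_
  have h := congrArg (fun r => (ivdW i A A' * ivdW j B B' * ivdW k C C') • r) (S.cR_jacobi i j k l)
  simp only [smul_add, smul_zero] at h
  rw [← h]
  simp only [mul_comm, mul_left_comm]

/-- The spin basis of a Lorentzian spin manifold. -/
def nullFrame (S : SpinSpacetime M) : NullFrame (smoothFn M) where
  e := S.eN
  w := S.wN
  v := S.vN
  w_trace := S.wN_trace
  v_trace := S.vN_trace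
  comm := S.eN_comm
  jacobi := S.nullStruct_jacobi

end SpinSpacetime
end

noncomputable section

theorem nullStruct_antisymm {R : Type*} [CommRing R] (w v : Fin 2 → Fin 2 → Fin 2 → Fin 2 → R)
    (A A' B B' C C' : Fin 2) :
    nullStruct w v A A' B B' C C' = -nullStruct w v B B' A A' C C' := by
  simp only [nullStruct]; ring

theorem eq_zero_of_eq_neg {R : Type*} [CommRing R] [Algebra ℂ R] {r : R} (h : r = -r) : r = 0 := by
  have h2 : (2 : ℂ) • r = 0 := by rw [two_smul]; linear_combination h
  have h3 := congrArg (fun r => (1 / 2 : ℂ) • r) h2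
  simpa [smul_smul] using h3

namespace NullFrame

variable {R : Type*} [CommRing R] [Algebra ℂ R] (N : NullFrame R)

theorem curv_antisymm (u : Fin 2 → Fin 2 → Fin 2 → Fin 2 → R) (A A' B B' C D : Fin 2) :
    N.curv u A A' B B' C D = -N.curv u B B' A A' C D := by
  simp only [curv, Fin.sum_univ_two, nullStruct_antisymm N.w N.v B B' A A']
  ring

theorem curv_trace (A A' B B' : Fin 2) :
    N.curv N.w A A' B B' 1 1 = -N.curv N.w A A' B B' 0 0 := by
  simp only [curv, Fin.sum_univ_two, N.w_trace, map_neg]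
  ring

/-- The second Bianchi identity. -/
theorem second_bianchi (u : Fin 2 → Fin 2 → Fin 2 → Fin 2 → R) (A A' B B' C C' P Q : Fin 2) :
    (N.e A A' (N.curv u B B' C C' P Q)
        - ∑ T, (u A A' P T * N.curv u B B' C C' T Q - N.curv u B B' C C' P T * u A A' T Q)
        + ∑ F, ∑ F', nullStruct N.w N.v A A' B B' F F' * N.curv u C C' F F' P Q)
    + (N.e B B' (N.curv u C C' A A' P Q)
        - ∑ T, (u B B' P T * N.curv u C C' A A' T Q - N.curv u C C' A A' P T * u B B' T Q)
        + ∑ F, ∑ F', nullStruct N.w N.v B B' C C' F F' * N.curv u A A' F F' P Q)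
    + (N.e C C' (N.curv u A A' B B' P Q)
        - ∑ T, (u C C' P T * N.curv u A A' B B' T Q - N.curv u A A' B B' P T * u C C' T Q)
        + ∑ F, ∑ F', nullStruct N.w N.v C C' A A' F F' * N.curv u B B' F F' P Q) = 0 := by
  have h1 := N.comm A A' B B' (u C C' P Q)
  have h2 := N.comm B B' C C' (u A A' P Q)
  have h3 := N.comm C C' A A' (u B B' P Q)
  have hJ := fun D D' => N.jacobi A A' B B' C C' D D'
  simp only [Fin.sum_univ_two] at h1 h2 h3 hJ
  simp only [curv, Fin.sum_univ_two, map_add, map_sub, Derivation.leibniz, smul_eq_mul]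
  linear_combination h1 + h2 + h3 - u 0 0 P Q * hJ 0 0 - u 0 1 P Q * hJ 0 1 - u 1 0 P Q * hJ 1 0
    - u 1 1 P Q * hJ 1 1

/-- Four components of the first Bianchi identity. -/
theorem first_bianchi :
    (N.curv N.w 0 0 0 1 1 1 + N.curv N.v 0 0 0 1 0 0 + N.curv N.w 0 1 1 0 0 1 = 0 ∧
    N.curv N.w 0 0 0 1 1 0 + N.curv N.w 0 1 1 0 0 0 + N.curv N.v 0 1 1 0 0 0
      + N.curv N.v 1 0 0 0 1 0 = 0) ∧
    (N.curv N.w 0 0 1 1 1 0 + N.curv N.w 1 1 1 0 0 0 + N.curv N.v 1 1 1 0 0 0 = 0 ∧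
    N.curv N.w 0 0 1 1 1 1 + N.curv N.v 0 0 1 1 0 0 + N.curv N.w 1 1 1 0 0 1
      + N.curv N.v 1 0 0 0 1 0 = 0) := by
  have h1 := N.jacobi 0 0 0 1 1 0 1 0
  have h2 := N.jacobi 0 0 0 1 1 0 0 0
  have h3 := N.jacobi 0 0 1 1 1 0 0 0
  have h4 := N.jacobi 0 0 1 1 1 0 1 0
  simp only [nullStruct, Fin.sum_univ_two, if_true, if_false, zero_ne_one, one_ne_zero, mul_one,
    mul_zero, one_mul, zero_mul, add_zero, zero_add, sub_zero, zero_sub, map_add, map_sub, map_neg,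
    neg_mul, sub_self] at h1 h2 h3 h4
  refine ⟨⟨?_, ?_⟩, ?_, ?_⟩
  all_goals
    simp only [curv, nullStruct, Fin.sum_univ_two, if_true, if_false, zero_ne_one, one_ne_zero, mul_one,
    mul_zero, one_mul, zero_mul, add_zero, zero_add, sub_zero, zero_sub]
  · linear_combination h1
  · linear_combination h2
  · linear_combination h3
  · linear_combination h4

/-- `Φ_{ABA'B'} = 0` and its complex conjugate. -/
structure RicciTraceFree : Prop where
  ricci : ∀ A' B' C D, N.curv N.w 0 A' 1 B' C D = N.curv N.w 1 A' 0 B' C D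
  ricci_conj : ∀ A B C D, N.curv N.v A 0 B 1 C D = N.curv N.v A 1 B 0 C D

/-- `Φ_{ABA'B'} = 0`, its complex conjugate, and constancy of `Λ`. -/
structure IsEinstein : Prop extends N.RicciTraceFree where
  scalar : ∀ A A', N.e A A' (N.curv N.w 0 0 0 1 1 0 - N.curv N.w 0 0 1 1 0 0) = 0

variable {N}

/-- If `Φ_{ABA'B'} = 0`, the curvature vanishes when two primed indices agree. -/
theorem RicciTraceFree.curv_self (h : N.RicciTraceFree) (A A' B C D : Fin 2) :
    N.curv N.w A A' B A' C D = 0 := by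
  have h1 : N.curv N.w 0 A' 1 A' C D = 0 := eq_zero_of_eq_neg (by
    conv_lhs => rw [h.ricci, curv_antisymm])
  have h2 : ∀ A, N.curv N.w A A' A A' C D = 0 := fun A => eq_zero_of_eq_neg (by
    conv_lhs => rw [curv_antisymm])
  fin_cases A <;> fin_cases B
  · exact h2 0
  · exact h1
  · exact (h.ricci A' A' C D).symm.trans h1
  · exact h2 1

theorem RicciTraceFree.curv_symm (h : N.RicciTraceFree) (C D : Fin 2) :
    N.curv N.w 1 0 0 1 C D = N.curv N.w 0 0 1 1 C D := (h.ricci 0 1 C D).symm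

/-- The pair symmetry `X_{ABCD} = X_{CDAB}`. -/
theorem RicciTraceFree.pair_symm (h : N.RicciTraceFree) :
    N.curv N.w 0 0 0 1 1 1 = N.curv N.w 0 0 1 1 0 1 ∧
    N.curv N.w 0 0 1 1 1 0 = N.curv N.w 1 0 1 1 0 0 ∧
    N.curv N.w 0 0 0 1 1 0 = -N.curv N.w 1 0 1 1 0 1 := by
  obtain ⟨⟨h1, h2⟩, h3, h4⟩ := N.first_bianchi
  have g1 : ∀ A C D, N.curv N.v A 0 A 1 C D = 0 := fun A C D => eq_zero_of_eq_neg (by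
    conv_lhs => rw [h.ricci_conj, curv_antisymm])
  have g2 : ∀ A C D, N.curv N.v A 1 A 0 C D = 0 := fun A C D => by
    rw [← h.ricci_conj, g1]
  have g3 := h.ricci_conj 0 1 0 0
  have f1 : ∀ C D, N.curv N.w 0 1 1 0 C D = -N.curv N.w 0 0 1 1 C D := fun C D => by
    rw [h.ricci, curv_antisymm]
  have f2 : ∀ C D, N.curv N.w 1 1 1 0 C D = -N.curv N.w 1 0 1 1 C D := fun C D =>
    N.curv_antisymm N.w 1 1 1 0 C D
  rw [f1] at h1 h2
  rw [f2] at h3 h4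
  rw [g1] at h1
  rw [g2] at h3
  have ht := N.curv_trace 0 0 1 1
  refine ⟨?_, ?_, ?_⟩
  · linear_combination h1
  · linear_combination h3
  · linear_combination h2 - h4 + g3 + ht

/-- The Bianchi identity `∇_{0A'} Ψ_{1BCD} = ∇_{1A'} Ψ_{0BCD}` for the components `p` of a totally
symmetric spinor; `e₀, e₁` are the derivations `e_{0A'}, e_{1A'}` and `w₀, w₁` the corresponding
connection coefficients. -/
def _root_.WeylBianchi (e₀ e₁ : Derivation ℂ R R) (w₀ w₁ : Fin 2 → Fin 2 → R) (p : Fin 5 → R) :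
    Prop :=
  (e₀ (p 1) - (w₀ 1 0 * p 0 - w₀ 0 0 * p 1) - 3 * (w₀ 0 0 * p 1 + w₀ 0 1 * p 2)
    - (e₁ (p 0) - 4 * (w₁ 0 0 * p 0 + w₁ 0 1 * p 1)) = 0 ∧
  e₀ (p 2) - 2 * (w₀ 1 0 * p 1 - w₀ 0 0 * p 2) - 2 * (w₀ 0 0 * p 2 + w₀ 0 1 * p 3)
    - (e₁ (p 1) - (w₁ 1 0 * p 0 - w₁ 0 0 * p 1) - 3 * (w₁ 0 0 * p 1 + w₁ 0 1 * p 2)) = 0) ∧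
  (e₀ (p 3) - 3 * (w₀ 1 0 * p 2 - w₀ 0 0 * p 3) - (w₀ 0 0 * p 3 + w₀ 0 1 * p 4)
    - (e₁ (p 2) - 2 * (w₁ 1 0 * p 1 - w₁ 0 0 * p 2) - 2 * (w₁ 0 0 * p 2 + w₁ 0 1 * p 3)) = 0 ∧
  e₀ (p 4) - 4 * (w₀ 1 0 * p 3 - w₀ 0 0 * p 4)
    - (e₁ (p 3) - 3 * (w₁ 1 0 * p 2 - w₁ 0 0 * p 3) - (w₁ 0 0 * p 3 + w₁ 0 1 * p 4)) = 0)

variable (N) in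
/-- The components of the Weyl spinor in the spin basis. -/
def weyl : Fin 5 → R :=
  ![-N.curv N.w 0 0 0 1 0 1, N.curv N.w 0 0 0 1 0 0,
    (1 / 3 : ℂ) • (N.curv N.w 0 0 0 1 1 0 + 2 * N.curv N.w 0 0 1 1 0 0),
    N.curv N.w 0 0 1 1 1 0, N.curv N.w 1 0 1 1 1 0]

variable (N) in
theorem weyl_zero : N.weyl 0 = -N.curv N.w 0 0 0 1 0 1 := rfl

variable (N) in
theorem weyl_one : N.weyl 1 = N.curv N.w 0 0 0 1 0 0 := rfl

variable (N) in
theorem weyl_two : N.weyl 2 =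
    (1 / 3 : ℂ) • (N.curv N.w 0 0 0 1 1 0 + 2 * N.curv N.w 0 0 1 1 0 0) := rfl

variable (N) in
theorem weyl_three : N.weyl 3 = N.curv N.w 0 0 1 1 1 0 := rfl

variable (N) in
theorem weyl_four : N.weyl 4 = N.curv N.w 1 0 1 1 1 0 := rfl

/-- The Bianchi identity for the Weyl spinor of an Einstein space. -/
theorem IsEinstein.weylBianchi (h : N.IsEinstein) (A' : Fin 2) :
    WeylBianchi (N.e 0 A') (N.e 1 A') (N.w 0 A') (N.w 1 A') N.weyl := by
  obtain ⟨q1, q2, q3⟩ := h.pair_symm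
  have hs1 : ∀ A B C D, N.curv N.w A 1 B 0 C D = -N.curv N.w B 0 A 1 C D := fun A B C D =>
    N.curv_antisymm N.w A 1 B 0 C D
  have ht := fun A A' B B' => N.curv_trace A A' B B'
  have hp2 : N.weyl 2 = (1 / 3 : ℂ) • (N.curv N.w 0 0 0 1 1 0 + 2 * N.curv N.w 0 0 1 1 0 0) :=
    N.weyl_two
  set L : R := (1 / 3 : ℂ) • (N.curv N.w 0 0 0 1 1 0 - N.curv N.w 0 0 1 1 0 0) with hL
  have hdL : ∀ A A', N.e A A' L = 0 := fun A A' => by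
    rw [hL, Derivation.map_smul, h.scalar, smul_zero]
  have third : ∀ r : R, (1 / 3 : ℂ) • r + (1 / 3 : ℂ) • r + (1 / 3 : ℂ) • r = r := fun r => by
    rw [← add_smul, ← add_smul]; norm_num
  have ha : N.curv N.w 0 0 0 1 1 0 = N.weyl 2 + 2 * L := by
    rw [hp2, hL, smul_add, smul_sub, mul_comm, ← smul_mul_assoc]
    linear_combination -third (N.curv N.w 0 0 0 1 1 0)
  have hb : N.curv N.w 0 0 1 1 0 0 = N.weyl 2 - L := by
    rw [hp2, hL, smul_add, smul_sub, mul_comm, ← smul_mul_assoc]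
    linear_combination -third (N.curv N.w 0 0 1 1 0 0)
  have hp0 : N.curv N.w 0 0 0 1 0 1 = -N.weyl 0 := by rw [weyl_zero, neg_neg]
  have hp1 : N.curv N.w 0 0 0 1 0 0 = N.weyl 1 := N.weyl_one.symm
  have hp3 : N.curv N.w 0 0 1 1 1 0 = N.weyl 3 := N.weyl_three.symm
  have hp4 : N.curv N.w 1 0 1 1 1 0 = N.weyl 4 := N.weyl_four.symm
  have hp1' : N.curv N.w 0 0 1 1 0 1 = -N.weyl 1 := by rw [← q1, ht, hp1]
  have hp3' : N.curv N.w 1 0 1 1 0 0 = N.weyl 3 := by rw [← q2, hp3]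
  have ha' : N.curv N.w 1 0 1 1 0 1 = -(N.weyl 2 + 2 * L) := by rw [← ha, q3, neg_neg]
  generalize N.weyl = p at *
  have hset := fun C P Q => N.second_bianchi N.w 0 0 1 0 C 1 P Q
  have hset' := fun C P Q => N.second_bianchi N.w 0 1 C 0 1 1 P Q
  obtain rfl | rfl : A' = 0 ∨ A' = 1 := by fin_cases A' <;> simp
  · have b0 := hset 0 0 1
    have b1 := hset 0 0 0
    have b2 := hset 1 0 0
    have b3 := hset 1 1 0
    simp only [Fin.sum_univ_two, h.curv_self, hs1, h.curv_symm, ht, hp0, hp1, hp3, hp4, hp1', hp3',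
      ha', ha, hb, nullStruct, if_true, if_false, zero_ne_one, one_ne_zero, mul_one,
      mul_zero, one_mul, zero_mul, add_zero, zero_add, sub_zero, zero_sub, map_sub,
      map_neg, map_zero, neg_mul, sub_self, N.w_trace, N.v_trace, hdL] at b0 b1 b2 b3
    refine ⟨⟨?_, ?_⟩, ?_, ?_⟩
    · linear_combination -b0
    · linear_combination b1
    · linear_combination b2
    · linear_combination b3
  · have b0 := hset' 0 0 1
    have b1 := hset' 0 0 0
    have b2 := hset' 1 0 0
    have b3 := hset' 1 1 0
    simp only [Fin.sum_univ_two, h.curv_self, hs1, h.curv_symm, ht, hp0, hp1, hp3, hp4, hp1', hp3',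
      ha', ha, hb, nullStruct, if_true, if_false, zero_ne_one, one_ne_zero, mul_one,
      mul_zero, one_mul, zero_mul, add_zero, zero_add, sub_zero, zero_sub, map_sub,
      map_neg, map_zero, neg_mul, sub_self, N.w_trace, N.v_trace, hdL] at b0 b1 b2 b3
    refine ⟨⟨?_, ?_⟩, ?_, ?_⟩
    · linear_combination -b0
    · linear_combination b1
    · linear_combination b2
    · linear_combination b3

end NullFrame
end

noncomputable section

section Dyad

variable {R : Type*} [CommRing R] [Algebra ℂ R]

/-- A covector is determined by its components in a normalised dyad. -/
theorem dyad_components {R : Type*} [CommRing R] {o₀ o₁ i₀ i₁ x₀ x₁ a b : R} (hn : o₀ * i₁ - o₁ * i₀ = 1)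
    (ha : o₀ * x₀ + o₁ * x₁ = a) (hb : i₀ * x₀ + i₁ * x₁ = b) :
    x₀ = i₁ * a - o₁ * b ∧ x₁ = o₀ * b - i₀ * a := by
  constructor
  · linear_combination i₁ * ha - o₁ * hb - x₀ * hn
  · linear_combination o₀ * hb - i₀ * ha - x₁ * hn

/-- `∇_A κ^0` along a derivation `e` with connection coefficients `w`. -/
def nab₀ (e : Derivation ℂ R R) (w : Fin 2 → Fin 2 → R) (k₀ k₁ : R) : R :=
  e k₀ + k₀ * w 0 0 + k₁ * w 1 0

/-- `∇_A κ^1` along a derivation `e` with trace-free connection coefficients `w`. -/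
def nab₁ (e : Derivation ℂ R R) (w : Fin 2 → Fin 2 → R) (k₀ k₁ : R) : R :=
  e k₁ + k₀ * w 0 1 - k₁ * w 0 0

/-- `κ^B ∇ λ_B` along a derivation `e` with trace-free connection coefficients `w`. -/
def pair (e : Derivation ℂ R R) (w : Fin 2 → Fin 2 → R) (k₀ k₁ l₀ l₁ : R) : R :=
  k₁ * nab₀ e w l₀ l₁ - k₀ * nab₁ e w l₀ l₁

/-- In a type II Einstein space `o^A o^B ∇_{AA'} o_B = 0`, and
`o^A ∇_{AA'} Ψ₂ = 3 Ψ₂ ι^A o^B ∇_{AA'} o_B`. -/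
theorem WeylBianchi.typeII {e₀ e₁ : Derivation ℂ R R} {w₀ w₁ : Fin 2 → Fin 2 → R} {p : Fin 5 → R}
    (hB : WeylBianchi e₀ e₁ w₀ w₁ p) {o₀ o₁ i₀ i₁ q : R} (hn : o₀ * i₁ - o₁ * i₀ = 1)
    (h0 : p 0 * o₀ ^ 4 + 4 * p 1 * o₀ ^ 3 * o₁ + 6 * p 2 * o₀ ^ 2 * o₁ ^ 2
      + 4 * p 3 * o₀ * o₁ ^ 3 + p 4 * o₁ ^ 4 = 0)
    (h1 : i₀ * (p 0 * o₀ ^ 3 + 3 * p 1 * o₀ ^ 2 * o₁ + 3 * p 2 * o₀ * o₁ ^ 2 + p 3 * o₁ ^ 3)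
      + i₁ * (p 1 * o₀ ^ 3 + 3 * p 2 * o₀ ^ 2 * o₁ + 3 * p 3 * o₀ * o₁ ^ 2 + p 4 * o₁ ^ 3) = 0)
    (h2 : i₀ ^ 2 * (p 0 * o₀ ^ 2 + 2 * p 1 * o₀ * o₁ + p 2 * o₁ ^ 2)
      + 2 * i₀ * i₁ * (p 1 * o₀ ^ 2 + 2 * p 2 * o₀ * o₁ + p 3 * o₁ ^ 2)
      + i₁ ^ 2 * (p 2 * o₀ ^ 2 + 2 * p 3 * o₀ * o₁ + p 4 * o₁ ^ 2) = q)
    (hq : ∀ r : R, 3 * q * r = 0 → r = 0) :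
    o₀ * pair e₀ w₀ o₀ o₁ o₀ o₁ + o₁ * pair e₁ w₁ o₀ o₁ o₀ o₁ = 0 ∧
    o₀ * e₀ q + o₁ * e₁ q =
      3 * q * (i₀ * pair e₀ w₀ o₀ o₁ o₀ o₁ + i₁ * pair e₁ w₁ o₀ o₁ o₀ o₁) := by
  obtain ⟨⟨b0, b1⟩, b2, b3⟩ := hB
  -- the contractions `Ψ_{Aooo}`, `Ψ_{ABoo}`, `Ψ_{Aιoo}`, `Ψ_{Aoιι}`
  obtain ⟨P0, P1⟩ := dyad_components hn
    (x₀ := p 0 * o₀ ^ 3 + 3 * p 1 * o₀ ^ 2 * o₁ + 3 * p 2 * o₀ * o₁ ^ 2 + p 3 * o₁ ^ 3)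
    (x₁ := p 1 * o₀ ^ 3 + 3 * p 2 * o₀ ^ 2 * o₁ + 3 * p 3 * o₀ * o₁ ^ 2 + p 4 * o₁ ^ 3)
    (a := 0) (b := 0) (by linear_combination h0) h1
  simp only [mul_zero, sub_zero] at P0 P1
  obtain ⟨R0, R1⟩ := dyad_components hn
    (x₀ := i₀ * (p 0 * o₀ ^ 2 + 2 * p 1 * o₀ * o₁ + p 2 * o₁ ^ 2)
      + i₁ * (p 1 * o₀ ^ 2 + 2 * p 2 * o₀ * o₁ + p 3 * o₁ ^ 2))
    (x₁ := i₀ * (p 1 * o₀ ^ 2 + 2 * p 2 * o₀ * o₁ + p 3 * o₁ ^ 2)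
      + i₁ * (p 2 * o₀ ^ 2 + 2 * p 3 * o₀ * o₁ + p 4 * o₁ ^ 2))
    (a := 0) (b := q) (by linear_combination i₀ * P0 + i₁ * P1) (by linear_combination h2)
  simp only [mul_zero, sub_zero, zero_sub] at R0 R1
  obtain ⟨Q00, Q01⟩ := dyad_components hn
    (x₀ := p 0 * o₀ ^ 2 + 2 * p 1 * o₀ * o₁ + p 2 * o₁ ^ 2)
    (x₁ := p 1 * o₀ ^ 2 + 2 * p 2 * o₀ * o₁ + p 3 * o₁ ^ 2)
    (a := 0) (b := -(o₁ * q)) (by linear_combination P0) (by linear_combination R0)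
  obtain ⟨-, Q11⟩ := dyad_components hn
    (x₀ := p 1 * o₀ ^ 2 + 2 * p 2 * o₀ * o₁ + p 3 * o₁ ^ 2)
    (x₁ := p 2 * o₀ ^ 2 + 2 * p 3 * o₀ * o₁ + p 4 * o₁ ^ 2)
    (a := 0) (b := o₀ * q) (by linear_combination P1) (by linear_combination R1)
  simp only [mul_zero, sub_zero, zero_sub] at Q00 Q01 Q11
  set K00 := i₀ * (p 0 * o₀ + p 1 * o₁) + i₁ * (p 1 * o₀ + p 2 * o₁) with hK00
  set K01 := i₀ * (p 1 * o₀ + p 2 * o₁) + i₁ * (p 2 * o₀ + p 3 * o₁) with hK01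
  set K11 := i₀ * (p 2 * o₀ + p 3 * o₁) + i₁ * (p 3 * o₀ + p 4 * o₁) with hK11
  set Z0 := i₀ * K00 + i₁ * K01 with hZ0
  set Z1 := i₀ * K01 + i₁ * K11 with hZ1
  set r := i₀ * Z0 + i₁ * Z1 with hr
  obtain ⟨Z0', Z1'⟩ := dyad_components hn (x₀ := Z0) (x₁ := Z1) (a := q) (b := r)
    (by rw [hZ0, hZ1, hK00, hK01, hK11]; linear_combination i₀ * R0 + i₁ * R1 + q * hn) rfl
  obtain ⟨K00', K01'⟩ := dyad_components hn (x₀ := K00) (x₁ := K01) (a := -(o₁ * q)) (b := Z0)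
    (by rw [hK00, hK01]; linear_combination R0) rfl
  obtain ⟨K10', K11'⟩ := dyad_components hn (x₀ := K01) (x₁ := K11) (a := o₀ * q) (b := Z1)
    (by rw [hK01, hK11]; linear_combination R1) rfl
  have dn : ∀ e : Derivation ℂ R R, o₀ * e i₁ + i₁ * e o₀ - (o₁ * e i₀ + i₀ * e o₁) = 0 := by
    intro e
    have h := congrArg e hn
    simpa only [map_sub, Derivation.leibniz, smul_eq_mul, Derivation.map_one_eq_zero] using h
  have hj : ∀ (e : Derivation ℂ R R) (w : Fin 2 → Fin 2 → R),
      o₀ * nab₁ e w i₀ i₁ + i₁ * nab₀ e w o₀ o₁ - (o₁ * nab₀ e w i₀ i₁ + i₀ * nab₁ e w o₀ o₁)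
        = 0 := by
    intro e w
    simp only [nab₀, nab₁]
    linear_combination dn e
  have hj₀ := hj e₀ w₀
  have hj₁ := hj e₁ w₁
  have d3 : ∀ e : Derivation ℂ R R, e 3 = 0 := fun e => e.map_natCast 3
  have d2 : ∀ e : Derivation ℂ R R, e 2 = 0 := fun e => e.map_natCast 2
  have hs : o₀ * pair e₀ w₀ o₀ o₁ o₀ o₁ + o₁ * pair e₁ w₁ o₀ o₁ o₀ o₁ = 0 := by
    apply hq
    have dP1 := congrArg e₀ P1
    have dP0 := congrArg e₁ P0
    simp only [map_add, Derivation.leibniz, Derivation.leibniz_pow, smul_eq_mul, map_zero, d3,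
      nsmul_eq_mul] at dP0 dP1
    push_cast at dP0 dP1
    simp only [pair]
    have key : 3 * ((p 1 * o₀ ^ 2 + 2 * p 2 * o₀ * o₁ + p 3 * o₁ ^ 2) * nab₀ e₀ w₀ o₀ o₁
        + (p 2 * o₀ ^ 2 + 2 * p 3 * o₀ * o₁ + p 4 * o₁ ^ 2) * nab₁ e₀ w₀ o₀ o₁
        - (p 0 * o₀ ^ 2 + 2 * p 1 * o₀ * o₁ + p 2 * o₁ ^ 2) * nab₀ e₁ w₁ o₀ o₁
        - (p 1 * o₀ ^ 2 + 2 * p 2 * o₀ * o₁ + p 3 * o₁ ^ 2) * nab₁ e₁ w₁ o₀ o₁) = 0 := by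
      simp only [nab₀, nab₁]
      linear_combination dP1 - dP0 - (w₀ 1 0 * P0 - w₀ 0 0 * P1) + (w₁ 0 0 * P0 + w₁ 0 1 * P1)
        - o₀ ^ 3 * b0 - 3 * o₀ ^ 2 * o₁ * b1 - 3 * o₀ * o₁ ^ 2 * b2 - o₁ ^ 3 * b3
    rw [Q00, Q01, Q11] at key
    linear_combination -key
  refine ⟨hs, ?_⟩
  have dR1 := congrArg e₀ R1
  have dR0 := congrArg e₁ R0
  simp only [map_add, map_neg, Derivation.leibniz, Derivation.leibniz_pow, smul_eq_mul, d2,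
    nsmul_eq_mul] at dR0 dR1
  push_cast at dR0 dR1
  have key : o₀ * e₀ q + o₁ * e₁ q + q * (nab₀ e₀ w₀ o₀ o₁ + nab₁ e₁ w₁ o₀ o₁) =
      (p 1 * o₀ ^ 2 + 2 * p 2 * o₀ * o₁ + p 3 * o₁ ^ 2) * nab₀ e₀ w₀ i₀ i₁
      + (p 2 * o₀ ^ 2 + 2 * p 3 * o₀ * o₁ + p 4 * o₁ ^ 2) * nab₁ e₀ w₀ i₀ i₁
      - (p 0 * o₀ ^ 2 + 2 * p 1 * o₀ * o₁ + p 2 * o₁ ^ 2) * nab₀ e₁ w₁ i₀ i₁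
      - (p 1 * o₀ ^ 2 + 2 * p 2 * o₀ * o₁ + p 3 * o₁ ^ 2) * nab₁ e₁ w₁ i₀ i₁
      + 2 * (K01 * nab₀ e₀ w₀ o₀ o₁ + K11 * nab₁ e₀ w₀ o₀ o₁
        - K00 * nab₀ e₁ w₁ o₀ o₁ - K01 * nab₁ e₁ w₁ o₀ o₁) := by
    simp only [nab₀, nab₁, hK00, hK01, hK11]
    linear_combination -dR1 + dR0 + (w₀ 1 0 * R0 - w₀ 0 0 * R1) - (w₁ 0 0 * R0 + w₁ 0 1 * R1)
      + i₀ * (o₀ ^ 2 * b0 + 2 * o₀ * o₁ * b1 + o₁ ^ 2 * b2)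
      + i₁ * (o₀ ^ 2 * b1 + 2 * o₀ * o₁ * b2 + o₁ ^ 2 * b3)
  simp only [pair] at hs ⊢
  linear_combination key + nab₀ e₀ w₀ i₀ i₁ * Q01 + nab₁ e₀ w₀ i₀ i₁ * Q11
    - nab₀ e₁ w₁ i₀ i₁ * Q00 - nab₁ e₁ w₁ i₀ i₁ * Q01
    + 2 * (nab₀ e₀ w₀ o₀ o₁ * K10' + nab₁ e₀ w₀ o₀ o₁ * K11'
      - nab₀ e₁ w₁ o₀ o₁ * K00' - nab₁ e₁ w₁ o₀ o₁ * K01')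
    + 2 * ((o₁ * nab₀ e₁ w₁ o₀ o₁ - o₀ * nab₁ e₁ w₁ o₀ o₁) * Z0'
      - (o₁ * nab₀ e₀ w₀ o₀ o₁ - o₀ * nab₁ e₀ w₀ o₀ o₁) * Z1')
    - 2 * r * hs + q * (o₀ * hj₀ + o₁ * hj₁)
    + q * (nab₀ e₀ w₀ o₀ o₁ + nab₁ e₁ w₁ o₀ o₁) * hn

end Dyad
end

noncomputable section

namespace SpinDyad

variable {M : Type*} [TopologicalSpace M] [ChartedSpace (EuclideanSpace ℝ (Fin 4)) M]

/-- The components of `o^A` as smooth functions. -/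
def oR (d : SpinDyad M) (A : Fin 2) : smoothFn M := ⟨fun x => d.o x A, d.smooth_o A⟩

/-- The components of `ι^A` as smooth functions. -/
def iR (d : SpinDyad M) (A : Fin 2) : smoothFn M := ⟨fun x => d.ι x A, d.smooth_ι A⟩

theorem eval_oR (d : SpinDyad M) (A : Fin 2) (x : M) :
    smoothFn.eval x (d.oR A) = d.o x A := rfl

theorem eval_iR (d : SpinDyad M) (A : Fin 2) (x : M) :
    smoothFn.eval x (d.iR A) = d.ι x A := rfl

theorem normR (d : SpinDyad M) : d.oR 0 * d.iR 1 - d.oR 1 * d.iR 0 = 1 := by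
  refine smoothFn.ext_eval fun x => ?_
  have h := d.normalised x
  simp only [lowerIdx, Fin.sum_univ_two, spinEps] at h
  simp at h
  simp only [map_sub, map_mul, map_one, d.eval_oR, d.eval_iR]
  linear_combination h

end SpinDyad

namespace SpinSpacetime

variable {M : Type*} [TopologicalSpace M] [ChartedSpace (EuclideanSpace ℝ (Fin 4)) M]
  [IsManifold (𝓡 4) ∞ M]

/-- The curvature `F_{AA'BB'C}{}^D` of the spin connection as smooth functions. -/
def curvN (S : SpinSpacetime M) : Fin 2 → Fin 2 → Fin 2 → Fin 2 → Fin 2 → Fin 2 → smoothFn M :=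
  S.nullFrame.curv S.wN

theorem eN_wN (S : SpinSpacetime M) (A A' B B' C D : Fin 2) :
    S.eN A A' (S.wN B B' C D) =
      ∑ i, ∑ j, (ivdW i A A' * ivdW j B B') • S.dR i (S.omR j C D) := by
  rw [wN, map_sum, Finset.sum_comm]
  refine Finset.sum_congr rfl fun j _ => ?_
  simp only [eN_apply, Derivation.map_smul, Finset.smul_sum, smul_smul, mul_comm]

theorem eval_curvN (S : SpinSpacetime M) (A A' B B' C D : Fin 2) (x : M) :
    smoothFn.eval x (S.curvN A A' B B' C D) =
      ∑ i, ∑ j, ivdW i A A' * ivdW j B B' * S.spinCurv i j C D x := by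
  have h1 := S.eN_wN A A' B B' C D
  have h2 := S.eN_wN B B' A A' C D
  rw [Finset.sum_comm] at h2
  simp only [mul_comm (ivdW _ B B')] at h2
  have h3 := S.sum_nullStruct_mul A A' B B' (fun k => S.omR k C D)
  have h4 : ∀ E, S.wN B B' C E * S.wN A A' E D =
      ∑ i, ∑ j, (ivdW i A A' * ivdW j B B') • (S.omR j C E * S.omR i E D) := by
    intro E
    simp only [wN, Finset.sum_mul, Finset.mul_sum, smul_mul_smul_comm]
    simp only [mul_comm]
  have h5 : ∀ E, S.wN A A' C E * S.wN B B' E D =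
      ∑ i, ∑ j, (ivdW i A A' * ivdW j B B') • (S.omR i C E * S.omR j E D) := by
    intro E
    simp only [wN, Finset.sum_mul, Finset.mul_sum, smul_mul_smul_comm]
    rw [Finset.sum_comm]
  have h : S.curvN A A' B B' C D = ∑ i, ∑ j, (ivdW i A A' * ivdW j B B') •
      (S.dR i (S.omR j C D) - S.dR j (S.omR i C D)
        + ∑ E, (S.omR j C E * S.omR i E D - S.omR i C E * S.omR j E D)
        - ∑ k, S.cR i j k * S.omR k C D) := by
    simp only [curvN, NullFrame.curv, nullFrame]
    simp only [smul_sub, smul_add, Finset.sum_sub_distrib, Finset.sum_add_distrib]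
    rw [h1, h2]
    congr 1
    · congr 1
      simp only [Fin.sum_univ_two, h4, h5, smul_add, Finset.sum_add_distrib]
  rw [h]
  simp only [map_sum, map_smul, map_sub, map_add, map_mul, smul_eq_mul, eval_dR, eval_omR, omR_coe,
    cR, smoothFn.eval_ofReal, spinCurv, Complex.ofReal_mul]

theorem spinCurvLow_eq (S : SpinSpacetime M) (A A' B B' C D : Fin 2) (x : M) :
    S.spinCurvLow A A' B B' C D x =
      lowerIdx (fun E => smoothFn.eval x (S.curvN A A' B B' C E)) D := by
  simp only [spinCurvLow, lowerIdx, eval_curvN, Finset.sum_mul, Finset.mul_sum]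
  rw [← sum_rotate]
  simp only [mul_assoc]

theorem conj_nullStruct (S : SpinSpacetime M) (A A' B B' C C' : Fin 2) :
    smoothFn.conj (nullStruct S.wN S.vN A A' B B' C C') =
      nullStruct S.wN S.vN A' A B' B C' C := by
  have hv : ∀ A A' B C, smoothFn.conj (S.vN A A' B C) = S.wN A' A B C := by
    intro A A' B C
    rw [← conj_wN, smoothFn.conj_conj]
  simp only [nullStruct, map_sub, map_add, map_mul, conj_wN, hv, apply_ite smoothFn.conj, map_one,
    map_zero]
  ring

theorem conj_curvN (S : SpinSpacetime M) (A A' B B' C D : Fin 2) :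
    smoothFn.conj (S.curvN A A' B B' C D) = S.nullFrame.curv S.vN A' A B' B C D := by
  simp only [curvN, NullFrame.curv, nullFrame, map_sub, map_add, map_sum, map_mul, conj_eN, conj_wN,
    conj_nullStruct]
  congr 1
  exact Finset.sum_comm

theorem IsEinstein.ricciTraceFree {S : SpinSpacetime M} (h : S.IsEinstein) :
    S.nullFrame.RicciTraceFree := by
  have h1 : ∀ A' B' C D, S.curvN 0 A' 1 B' C D = S.curvN 1 A' 0 B' C D := by
    intro A' B' C D
    refine smoothFn.ext_eval fun x => ?_
    have h0 := h.1 C 0 A' B' x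
    have h1 := h.1 C 1 A' B' x
    simp only [ricciSpinor, spinCurvLow_eq, lowerIdx, Fin.sum_univ_two] at h0 h1
    simp [spinEps] at h0 h1
    obtain rfl | rfl : D = 0 ∨ D = 1 := by fin_cases D <;> simp
    · linear_combination h1
    · linear_combination -h0
  refine ⟨h1, fun A B C D => ?_⟩
  have h2 := congrArg smoothFn.conj (h1 A B C D)
  rwa [conj_curvN, conj_curvN] at h2

theorem curvX_eq {S : SpinSpacetime M} (h : S.nullFrame.RicciTraceFree) (A B C D : Fin 2) (x : M) :
    S.curvX A B C D x = lowerIdx (fun E => smoothFn.eval x (S.curvN A 0 B 1 C E)) D := by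
  have h1 : ∀ E, S.curvN A 1 B 0 C E = -S.curvN A 0 B 1 C E := by
    intro E
    have hs : S.curvN A 1 B 0 C E = -S.curvN B 0 A 1 C E :=
      S.nullFrame.curv_antisymm S.wN A 1 B 0 C E
    have ht : S.curvN 1 0 0 1 C E = S.curvN 0 0 1 1 C E := h.curv_symm C E
    rw [hs]
    fin_cases A <;> fin_cases B
    · rfl
    · exact congrArg _ ht
    · exact congrArg _ ht.symm
    · rfl
  have hself : ∀ A' E, S.curvN A A' B A' C E = 0 := fun A' E => h.curv_self A A' B C E
  simp only [curvX, spinCurvLow_eq, h1, hself, lowerIdx, Fin.sum_univ_two, spinEps, map_neg]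
  simp
  ring

/-- The components of the Weyl spinor as smooth functions. -/
def weylN (S : SpinSpacetime M) : Fin 5 → smoothFn M := S.nullFrame.weyl

/-- The components of `X_{ABCD}` when `Φ_{ABA'B'} = 0`. -/
theorem curvX_components {S : SpinSpacetime M} (h : S.nullFrame.RicciTraceFree) (x : M) :
    ((S.curvX 0 0 0 0 x = smoothFn.eval x (S.weylN 0) ∧
      S.curvX 1 1 1 1 x = smoothFn.eval x (S.weylN 4)) ∧
    (S.curvX 0 0 0 1 x = smoothFn.eval x (S.weylN 1) ∧
      S.curvX 0 0 1 0 x = smoothFn.eval x (S.weylN 1) ∧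
      S.curvX 0 1 0 0 x = smoothFn.eval x (S.weylN 1) ∧
      S.curvX 1 0 0 0 x = smoothFn.eval x (S.weylN 1)) ∧
    (S.curvX 1 1 1 0 x = smoothFn.eval x (S.weylN 3) ∧
      S.curvX 1 1 0 1 x = smoothFn.eval x (S.weylN 3) ∧
      S.curvX 1 0 1 1 x = smoothFn.eval x (S.weylN 3) ∧
      S.curvX 0 1 1 1 x = smoothFn.eval x (S.weylN 3))) ∧
    (S.curvX 0 0 1 1 x = smoothFn.eval x (S.curvN 0 0 0 1 1 0) ∧
      S.curvX 1 1 0 0 x = smoothFn.eval x (S.curvN 0 0 0 1 1 0)) ∧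
    (S.curvX 0 1 0 1 x = smoothFn.eval x (S.curvN 0 0 1 1 0 0) ∧
      S.curvX 0 1 1 0 x = smoothFn.eval x (S.curvN 0 0 1 1 0 0) ∧
      S.curvX 1 0 0 1 x = smoothFn.eval x (S.curvN 0 0 1 1 0 0) ∧
      S.curvX 1 0 1 0 x = smoothFn.eval x (S.curvN 0 0 1 1 0 0)) := by
  have low : ∀ (f : Fin 2 → ℂ), lowerIdx f 0 = -f 1 ∧ lowerIdx f 1 = f 0 := by
    intro f; constructor <;> simp [lowerIdx, spinEps]
  obtain ⟨q1, q2, q3⟩ := h.pair_symm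
  change S.curvN 0 0 0 1 1 1 = S.curvN 0 0 1 1 0 1 at q1
  change S.curvN 0 0 1 1 1 0 = S.curvN 1 0 1 1 0 0 at q2
  change S.curvN 0 0 0 1 1 0 = -S.curvN 1 0 1 1 0 1 at q3
  have hsymm : ∀ C D, S.curvN 1 0 0 1 C D = S.curvN 0 0 1 1 C D := h.curv_symm
  have ht : ∀ A A' B B', S.curvN A A' B B' 1 1 = -S.curvN A A' B B' 0 0 := S.nullFrame.curv_trace
  have hp0 : S.weylN 0 = -S.curvN 0 0 0 1 0 1 := S.nullFrame.weyl_zero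
  have hp1 : S.weylN 1 = S.curvN 0 0 0 1 0 0 := S.nullFrame.weyl_one
  have hp3 : S.weylN 3 = S.curvN 0 0 1 1 1 0 := S.nullFrame.weyl_three
  have hp4 : S.weylN 4 = S.curvN 1 0 1 1 1 0 := S.nullFrame.weyl_four
  simp only [curvX_eq h, (low _).1, (low _).2, hp0, hp1, hp3, hp4, hsymm, ← q1, ← q2, q3, ht,
    map_neg, neg_neg, and_self]

theorem IsEinstein.nullFrame {S : SpinSpacetime M} (h : S.IsEinstein) :
    S.nullFrame.IsEinstein := by
  have hr := h.ricciTraceFree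
  refine ⟨hr, fun A A' => ?_⟩
  obtain ⟨c, hc⟩ := h.2
  have hconst : S.curvN 0 0 0 1 1 0 - S.curvN 0 0 1 1 0 0 =
      algebraMap ℂ (smoothFn M) (3 * c) := by
    refine smoothFn.ext_eval fun x => ?_
    obtain ⟨-, ⟨ha, ha'⟩, -, hb, hb', -⟩ := curvX_components hr x
    have hx := hc x
    simp only [scalarLambda, Fin.sum_univ_two] at hx
    simp [spinEps, ha, ha', hb, hb'] at hx
    rw [AlgHom.commutes, map_sub]
    change _ = (3 * c : ℂ)
    linear_combination 3 * hx
  change S.eN A A' (S.curvN 0 0 0 1 1 0 - S.curvN 0 0 1 1 0 0) = 0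
  rw [hconst, Derivation.map_algebraMap]

/-- The Weyl spinor of an Einstein space in terms of its five components. -/
theorem weylContract_eq {S : SpinSpacetime M} (h : S.IsEinstein) (α β γ δ : M → Fin 2 → ℂ) (x : M)
    (p : Fin 5 → ℂ) (hp : ∀ n, p n = smoothFn.eval x (S.weylN n)) :
    S.weylContract α β γ δ x =
      p 0 * (α x 0 * β x 0 * γ x 0 * δ x 0)
      + p 1 * (α x 1 * β x 0 * γ x 0 * δ x 0 + α x 0 * β x 1 * γ x 0 * δ x 0
        + α x 0 * β x 0 * γ x 1 * δ x 0 + α x 0 * β x 0 * γ x 0 * δ x 1)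
      + p 2 * (α x 1 * β x 1 * γ x 0 * δ x 0 + α x 1 * β x 0 * γ x 1 * δ x 0
        + α x 1 * β x 0 * γ x 0 * δ x 1 + α x 0 * β x 1 * γ x 1 * δ x 0
        + α x 0 * β x 1 * γ x 0 * δ x 1 + α x 0 * β x 0 * γ x 1 * δ x 1)
      + p 3 * (α x 0 * β x 1 * γ x 1 * δ x 1 + α x 1 * β x 0 * γ x 1 * δ x 1
        + α x 1 * β x 1 * γ x 0 * δ x 1 + α x 1 * β x 1 * γ x 1 * δ x 0)
      + p 4 * (α x 1 * β x 1 * γ x 1 * δ x 1) := by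
  obtain ⟨⟨⟨h0, h4⟩, ⟨h1, h1a, h1b, h1c⟩, h3, h3a, h3b, h3c⟩, ⟨ha, ha'⟩, hb, hb1, hb2, hb3⟩ :=
    curvX_components h.ricciTraceFree x
  have h2 : smoothFn.eval x (S.weylN 2) = (1 / 3) * (smoothFn.eval x (S.curvN 0 0 0 1 1 0) +
      2 * smoothFn.eval x (S.curvN 0 0 1 1 0 0)) := by
    have : S.weylN 2 = (1 / 3 : ℂ) • (S.curvN 0 0 0 1 1 0 + 2 * S.curvN 0 0 1 1 0 0) :=
      S.nullFrame.weyl_two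
    rw [this, map_smul, map_add, map_mul, map_ofNat, smul_eq_mul]
  simp only [weylContract, weylSpinor, Fin.sum_univ_two, h0, h4, h1, h1a, h1b, h1c, h3, h3a, h3b,
    h3c, ha, ha', hb, hb1, hb2, hb3, hp, h2]
  ring

/-- `o^B ∇_{AA'} o_B`. -/
def kN (S : SpinSpacetime M) (d : SpinDyad M) (A A' : Fin 2) : smoothFn M :=
  pair (S.eN A A') (S.wN A A') (d.oR 0) (d.oR 1) (d.oR 0) (d.oR 1)

/-- In a type II Einstein space `o^A` is geodesic and shear-free, and
`o^A ∇_{AA'} log Ψ₂^{1/3} = ι^A o^B ∇_{AA'} o_B`. -/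
theorem typeII (S : SpinSpacetime M) (d : SpinDyad M) (hE : S.IsEinstein) (hII : S.IsTypeII d)
    (φ : smoothFn M) (hφ : ∀ x, smoothFn.eval x φ ^ 3 = S.Psi2 d x) (A' : Fin 2) :
    d.oR 0 * S.kN d 0 A' + d.oR 1 * S.kN d 1 A' = 0 ∧
    d.oR 0 * S.eN 0 A' φ + d.oR 1 * S.eN 1 A' φ =
      φ * (d.iR 0 * S.kN d 0 A' + d.iR 1 * S.kN d 1 A') := by
  have hφ0 : ∀ x, smoothFn.eval x φ ≠ 0 := fun x h0 => (hII x).2.2 (by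
    rw [← hφ x, h0]; simp)
  have hcancel : ∀ r : smoothFn M, φ * r = 0 → r = 0 := by
    intro r hr
    refine smoothFn.ext_eval fun x => ?_
    have := congrArg (smoothFn.eval x) hr
    rw [map_mul, map_zero] at this
    rw [map_zero]
    exact (mul_eq_zero.1 this).resolve_left (hφ0 x)
  have h3 : ∀ r : smoothFn M, 3 * r = 0 → r = 0 := by
    intro r hr
    refine smoothFn.ext_eval fun x => ?_
    have := congrArg (smoothFn.eval x) hr
    rw [map_mul, map_zero, map_ofNat] at this
    rw [map_zero]
    exact (mul_eq_zero.1 this).resolve_left (by norm_num)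
  have hB := hE.nullFrame.weylBianchi A'
  change WeylBianchi (S.eN 0 A') (S.eN 1 A') (S.wN 0 A') (S.wN 1 A') S.weylN at hB
  obtain ⟨hs, hq⟩ := hB.typeII d.normR (q := φ ^ 3)
    (by
      refine smoothFn.ext_eval fun x => ?_
      have h := (hII x).1
      rw [Psi0, weylContract_eq hE _ _ _ _ x (fun n => smoothFn.eval x (S.weylN n)) fun _ => rfl] at h
      simp only [map_add, map_mul, map_pow, map_ofNat, map_zero, d.eval_oR]
      linear_combination h)
    (by
      refine smoothFn.ext_eval fun x => ?_
      have h := (hII x).2.1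
      rw [Psi1, weylContract_eq hE _ _ _ _ x (fun n => smoothFn.eval x (S.weylN n)) fun _ => rfl] at h
      simp only [map_add, map_mul, map_pow, map_ofNat, map_zero, d.eval_oR, d.eval_iR]
      linear_combination h)
    (by
      refine smoothFn.ext_eval fun x => ?_
      have h := hφ x
      rw [Psi2, weylContract_eq hE _ _ _ _ x (fun n => smoothFn.eval x (S.weylN n)) fun _ => rfl] at h
      simp only [map_add, map_mul, map_pow, map_ofNat, d.eval_oR, d.eval_iR]
      linear_combination -h)
    (fun r hr => hcancel _ (hcancel _ (hcancel _ (h3 _ (by linear_combination hr)))))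
  refine ⟨hs, ?_⟩
  have hd : ∀ A, S.eN A A' (φ ^ 3) = 3 * φ ^ 2 * S.eN A A' φ := by
    intro A
    rw [Derivation.leibniz_pow, nsmul_eq_mul, smul_eq_mul]
    push_cast; ring
  rw [hd, hd] at hq
  have : φ * (φ * (3 * (d.oR 0 * S.eN 0 A' φ + d.oR 1 * S.eN 1 A' φ -
      φ * (d.iR 0 * S.kN d 0 A' + d.iR 1 * S.kN d 1 A')))) = 0 := by
    simp only [kN]
    linear_combination hq
  exact sub_eq_zero.1 (h3 _ (hcancel _ (hcancel _ this)))

end SpinSpacetime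
end

noncomputable section

namespace NullFrame

variable {R : Type*} [CommRing R] [Algebra ℂ R] (N : NullFrame R)

/-- `∇_{AA'} κ^B`. -/
def nab (k : Fin 2 → R) (A A' B : Fin 2) : R := N.e A A' (k B) + ∑ C, k C * N.w A A' C B

/-- `κ^B ∇_{AA'} λ_B`. -/
def pairing (k l : Fin 2 → R) (A A' : Fin 2) : R :=
  k 1 * N.nab l A A' 0 - k 0 * N.nab l A A' 1

/-- The Ricci identity `(∇_a ∇_b - ∇_b ∇_a) κ^P = F_{abQ}{}^P κ^Q`. -/
theorem ricci_identity (k : Fin 2 → R) (A A' B B' P : Fin 2) :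
    N.e A A' (N.nab k B B' P) + ∑ C, N.nab k B B' C * N.w A A' C P
      - (N.e B B' (N.nab k A A' P) + ∑ C, N.nab k A A' C * N.w B B' C P)
      - ∑ F, ∑ F', nullStruct N.w N.v A A' B B' F F' * N.nab k F F' P =
    ∑ Q, k Q * N.curv N.w A A' B B' Q P := by
  have h := N.comm A A' B B' (k P)
  simp only [Fin.sum_univ_two] at h
  simp only [nab, curv, Fin.sum_univ_two, map_add, Derivation.leibniz, smul_eq_mul]
  linear_combination h

section Dyad

variable {N} {o i : Fin 2 → R}

theorem nab_o (hn : o 0 * i 1 - o 1 * i 0 = 1) (A A' B : Fin 2) :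
    N.nab o A A' B = o B * N.pairing i o A A' - i B * N.pairing o o A A' := by
  simp only [pairing]
  obtain rfl | rfl : B = 0 ∨ B = 1 := by fin_cases B <;> simp
  · linear_combination -N.nab o A A' 0 * hn
  · linear_combination -N.nab o A A' 1 * hn

theorem nab_norm (hn : o 0 * i 1 - o 1 * i 0 = 1) (A A' : Fin 2) :
    o 0 * N.nab i A A' 1 + i 1 * N.nab o A A' 0 - (o 1 * N.nab i A A' 0 + i 0 * N.nab o A A' 1)
      = 0 := by
  have h := congrArg (N.e A A') hn
  simp only [map_sub, Derivation.leibniz, smul_eq_mul, Derivation.map_one_eq_zero] at h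
  simp only [nab, Fin.sum_univ_two, N.w_trace]
  linear_combination h

theorem nab_i (hn : o 0 * i 1 - o 1 * i 0 = 1) (A A' B : Fin 2) :
    N.nab i A A' B = o B * N.pairing i i A A' - i B * N.pairing i o A A' := by
  have h := nab_norm (N := N) hn A A'
  simp only [pairing]
  obtain rfl | rfl : B = 0 ∨ B = 1 := by fin_cases B <;> simp
  · linear_combination -N.nab i A A' 0 * hn + i 0 * h
  · linear_combination -N.nab i A A' 1 * hn + i 1 * h

/-- The curvature of the GHP connection form `ω_a = -ι^B ∇_a o_B`. -/
theorem curl_pairing (hn : o 0 * i 1 - o 1 * i 0 = 1) (A A' B B' : Fin 2) :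
    N.e A A' (N.pairing i o B B') - N.e B B' (N.pairing i o A A')
      - ∑ F, ∑ F', nullStruct N.w N.v A A' B B' F F' * N.pairing i o F F' =
    (∑ Q, o Q * (i 1 * N.curv N.w A A' B B' Q 0 - i 0 * N.curv N.w A A' B B' Q 1))
      + (N.pairing i i A A' * N.pairing o o B B' - N.pairing i i B B' * N.pairing o o A A') := by
  have r0 := N.ricci_identity o A A' B B' 0
  have r1 := N.ricci_identity o A A' B B' 1
  have key : N.pairing i i A A' * N.pairing o o B B' - N.pairing i i B B' * N.pairing o o A A' =
      N.nab i A A' 1 * N.nab o B B' 0 - N.nab i A A' 0 * N.nab o B B' 1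
        - (N.nab i B B' 1 * N.nab o A A' 0 - N.nab i B B' 0 * N.nab o A A' 1) := by
    simp only [nab_i hn, nab_o hn]
    linear_combination -(N.pairing i i A A' * N.pairing o o B B'
      - N.pairing i i B B' * N.pairing o o A A') * hn
  rw [key]
  simp only [Fin.sum_univ_two, pairing, map_sub, Derivation.leibniz, smul_eq_mul] at r0 r1 ⊢
  have hi : ∀ A A', N.e A A' (i 0) = N.nab i A A' 0 - i 0 * N.w A A' 0 0 - i 1 * N.w A A' 1 0 := by
    intro A A'; simp only [nab, Fin.sum_univ_two]; ring
  have hi' : ∀ A A', N.e A A' (i 1) = N.nab i A A' 1 - i 0 * N.w A A' 0 1 + i 1 * N.w A A' 0 0 := by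
    intro A A'; simp only [nab, Fin.sum_univ_two, N.w_trace]; ring
  simp only [N.w_trace, hi, hi'] at r0 r1 ⊢
  linear_combination i 1 * r0 - i 0 * r1

end Dyad

/-- `Θ̃_{A'} f = o^A (e_{AA'} + p ω_{AA'}) f` for a scalar of weight `{p,0}`. -/
def proj (o : Fin 2 → R) (g : Fin 2 → Fin 2 → R) (p : ℤ) (f : R) (A' : Fin 2) : R :=
  ∑ A, o A * (N.e A A' f + p * g A A' * f)

/-- `Θ̃_{A'} Y_{B'} = o^A (∇_{AA'} + p ω_{AA'}) Y_{B'}` for a primed spinor of weight `{p,0}`. -/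
def projSpinor (o : Fin 2 → R) (g : Fin 2 → Fin 2 → R) (p : ℤ) (Y : Fin 2 → R) (A' B' : Fin 2) : R :=
  ∑ A, o A * (N.e A A' (Y B') - ∑ C', N.v A A' B' C' * Y C' + p * g A A' * Y B')

/-- The operators `Θ̃_{A'}` commute on scalars if `Θ̃_{A'} o^B = 0` and the contracted curvature of
the GHP connection form vanishes. -/
theorem projSpinor_proj_symm {o : Fin 2 → R} {g : Fin 2 → Fin 2 → R}
    (H : ∀ A' B, ∑ A, o A * N.nab o A A' B = -(∑ A, o A * g A A') * o B)
    (G : ∑ A, ∑ B, o A * o B * (N.e A 0 (g B 1) - N.e B 1 (g A 0)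
      - ∑ F, ∑ F', nullStruct N.w N.v A 0 B 1 F F' * g F F') = 0) (p : ℤ) (f : R) (A' B' : Fin 2) :
    N.projSpinor o g (p + 1) (N.proj o g p f) A' B' =
      N.projSpinor o g (p + 1) (N.proj o g p f) B' A' := by
  have key : N.projSpinor o g (p + 1) (N.proj o g p f) 0 1 =
      N.projSpinor o g (p + 1) (N.proj o g p f) 1 0 := by
    have c := fun A B => N.comm A 0 B 1 f
    have dp : ∀ A A', N.e A A' (p : R) = 0 := fun A A' => (N.e A A').map_intCast p
    have H0 := H 0
    have H1 := H 1
    have H00 := H0 0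
    have H01 := H0 1
    have H10 := H1 0
    have H11 := H1 1
    have c00 := c 0 0
    have c01 := c 0 1
    have c10 := c 1 0
    have c11 := c 1 1
    clear H H0 H1 c
    simp only [nab, nullStruct, Fin.sum_univ_two, if_true, if_false, zero_ne_one, one_ne_zero,
      mul_one, mul_zero, one_mul, zero_mul, add_zero, zero_add, sub_zero, zero_sub, N.w_trace,
      N.v_trace] at H00 H01 H10 H11 c00 c01 c10 c11 G
    simp only [projSpinor, proj, Fin.sum_univ_two, map_add, Derivation.leibniz, smul_eq_mul, dp,
      N.v_trace]
    push_cast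
    linear_combination o 0 * o 0 * c00 + o 0 * o 1 * c01 + o 1 * o 0 * c10 + o 1 * o 1 * c11
      + p * f * G + (N.e 0 1 f + p * g 0 1 * f) * H00 + (N.e 1 1 f + p * g 1 1 * f) * H01
      - (N.e 0 0 f + p * g 0 0 * f) * H10 - (N.e 1 0 f + p * g 1 0 * f) * H11
  fin_cases A' <;> fin_cases B'
  · rfl
  · exact key
  · exact key.symm
  · rfl

end NullFrame
end

noncomputable section

namespace NullFrame

variable {R : Type*} [CommRing R] [Algebra ℂ R] (N : NullFrame R)

/-- `c^{A'} o^A Θ_{AA'} f` for a scalar of weight `{p,q}`: the operator `þ` for `c = ō`, and `ð` for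
`c = ῑ`. -/
def ghp (o c : Fin 2 → R) (g gb : Fin 2 → Fin 2 → R) (p q : ℤ) (f : R) : R :=
  ∑ A, ∑ A', o A * c A' * (N.e A A' f + (p * g A A' + q * gb A A') * f)

theorem ghp_eq_proj (o c : Fin 2 → R) (g gb : Fin 2 → Fin 2 → R) (p : ℤ) (f : R) :
    N.ghp o c g gb p 0 f = ∑ A', c A' * N.proj o g p f A' := by
  simp only [ghp, proj, Fin.sum_univ_two]
  push_cast
  ring

/-- `þ` or `ð` of a component of a primed spinor. -/
theorem ghp_sum (o c b : Fin 2 → R) (g gb : Fin 2 → Fin 2 → R) (p q : ℤ) (y : Fin 2 → R) :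
    N.ghp o c g gb p q (∑ B', b B' * y B') =
      ∑ A', ∑ B', c A' * b B' * N.projSpinor o g p y A' B'
        + ∑ B', (∑ A, ∑ A', o A * c A' * (N.e A A' (b B') + ∑ C', b C' * N.v A A' C' B'
          + q * gb A A' * b B')) * y B' := by
  simp only [ghp, projSpinor, Fin.sum_univ_two, map_add, Derivation.leibniz, smul_eq_mul]
  ring

/-- `Θ̃_{A'} (φ² y_{B'})` when `Θ̃_{A'} φ = t_{A'} φ`. -/
theorem projSpinor_sq_mul (o : Fin 2 → R) (g : Fin 2 → Fin 2 → R) (p : ℤ) (y t : Fin 2 → R) (φ : R)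
    (ht : ∀ A', ∑ A, o A * N.e A A' φ = φ * t A') (A' B' : Fin 2) :
    N.projSpinor o g p (fun C' => φ ^ 2 * y C') A' B' =
      φ ^ 2 * (N.projSpinor o g p y A' B' + 2 * t A' * y B') := by
  have h := ht A'
  simp only [projSpinor, Fin.sum_univ_two, Derivation.leibniz, Derivation.leibniz_pow, smul_eq_mul,
    nsmul_eq_mul] at h ⊢
  push_cast
  linear_combination 2 * φ * y B' * h

end NullFrame

/-- A symmetric tensor in terms of its components in a normalised dyad. -/
theorem symm_tensor_expand {R : Type*} [CommRing R] {o i : Fin 2 → R}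
    (hn : o 0 * i 1 - o 1 * i 0 = 1) (V : Fin 2 → Fin 2 → R) (hV : V 0 1 = V 1 0)
    (ol il : Fin 2 → R) (ho0 : ol 0 = -o 1) (ho1 : ol 1 = o 0) (hi0 : il 0 = -i 1)
    (hi1 : il 1 = i 0) (A B : Fin 2) :
    V A B = (∑ C, ∑ D, i C * i D * V C D) * ol A * ol B
      - (∑ C, ∑ D, o C * i D * V C D) * (ol A * il B + il A * ol B)
      + (∑ C, ∑ D, o C * o D * V C D) * il A * il B := by
  have h2 : (o 0 * i 1 - o 1 * i 0) ^ 2 = 1 := by rw [hn, one_pow]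
  obtain rfl | rfl : A = 0 ∨ A = 1 := by fin_cases A <;> simp
  all_goals obtain rfl | rfl : B = 0 ∨ B = 1 := by fin_cases B <;> simp
  all_goals simp only [Fin.sum_univ_two, ho0, ho1, hi0, hi1, hV]
  · linear_combination -V 0 0 * h2
  · linear_combination -V 1 0 * h2
  · linear_combination -V 1 0 * h2
  · linear_combination -V 1 1 * h2

namespace SpinSpacetime

variable {M : Type*} [TopologicalSpace M] [ChartedSpace (EuclideanSpace ℝ (Fin 4)) M]
  [IsManifold (𝓡 4) ∞ M]

theorem eval_eN (S : SpinSpacetime M) (A A' : Fin 2) (f : smoothFn M) (x : M) :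
    smoothFn.eval x (S.eN A A' f) = toSpinor (fun k => S.D k f x) A A' := by
  simp only [eN_apply, map_sum, map_smul, smul_eq_mul, eval_dR, toSpinor]

theorem eval_vN (S : SpinSpacetime M) (A A' B C : Fin 2) (x : M) :
    smoothFn.eval x (S.vN A A' B C) = toSpinor (fun k => conj (S.spinConn k B C x)) A A' := by
  simp only [vN, map_sum, map_smul, smul_eq_mul, smoothFn.eval_conj, eval_omR, toSpinor]

theorem eval_wN (S : SpinSpacetime M) (A A' B C : Fin 2) (x : M) :
    smoothFn.eval x (S.wN A A' B C) = toSpinor (fun k => S.spinConn k B C x) A A' := by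
  simp only [wN, map_sum, map_smul, smul_eq_mul, eval_omR, toSpinor]

theorem _root_.toSpinor_conj (T : Fin 4 → ℂ) (A A' : Fin 2) :
    toSpinor (fun k => conj (T k)) A A' = conj (toSpinor T A' A) := by
  simp only [toSpinor, map_sum, map_mul, conj_ivdW]

/-- `κ^B ∇_{AA'} λ_B` as a smooth function. -/
theorem toSpinor_connPair (S : SpinSpacetime M) (k l : Fin 2 → smoothFn M) (κ lam : M → Fin 2 → ℂ)
    (hk : ∀ x A, κ x A = smoothFn.eval x (k A)) (hl : ∀ A, (fun y => lam y A) = (l A : M → ℂ))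
    (x : M) (A A' : Fin 2) :
    toSpinor (S.connPair κ lam x) A A' = smoothFn.eval x (S.nullFrame.pairing k l A A') := by
  have hl' : ∀ A, lam x A = smoothFn.eval x (l A) := fun A => congrFun (hl A) x
  change _ = smoothFn.eval x (k 1 * (S.eN A A' (l 0) + ∑ C, l C * S.wN A A' C 0)
    - k 0 * (S.eN A A' (l 1) + ∑ C, l C * S.wN A A' C 1))
  simp only [map_sub, map_mul, map_add, eval_eN, eval_wN, toSpinor, connPair, lowerIdx,
    nabla, hl, hl', hk, Fin.sum_univ_two, Fin.sum_univ_four, spinEps]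
  simp
  ring

/-- The GHP connection form `ω_{AA'}` as a smooth function. -/
def gN (S : SpinSpacetime M) (d : SpinDyad M) (A A' : Fin 2) : smoothFn M :=
  -S.nullFrame.pairing d.iR d.oR A A'

/-- `ω̄_{AA'}` as a smooth function. -/
def gbN (S : SpinSpacetime M) (d : SpinDyad M) (A A' : Fin 2) : smoothFn M :=
  smoothFn.conj (S.gN d A' A)

/-- `ō^{A'}` as a smooth function. -/
def _root_.SpinDyad.obR {M : Type*} [TopologicalSpace M]
    [ChartedSpace (EuclideanSpace ℝ (Fin 4)) M] (d : SpinDyad M) (A : Fin 2) : smoothFn M :=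
  smoothFn.conj (d.oR A)

/-- `ῑ^{A'}` as a smooth function. -/
def _root_.SpinDyad.ibR {M : Type*} [TopologicalSpace M]
    [ChartedSpace (EuclideanSpace ℝ (Fin 4)) M] (d : SpinDyad M) (A : Fin 2) : smoothFn M :=
  smoothFn.conj (d.iR A)

theorem eval_gN (S : SpinSpacetime M) (d : SpinDyad M) (A A' : Fin 2) (x : M) :
    smoothFn.eval x (S.gN d A A') = toSpinor (S.ghpForm d x) A A' := by
  rw [gN, map_neg, ← S.toSpinor_connPair d.iR d.oR d.ι d.o (fun _ _ => rfl) (fun _ => rfl)]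
  simp [toSpinor, ghpForm]

theorem eval_gbN (S : SpinSpacetime M) (d : SpinDyad M) (A A' : Fin 2) (x : M) :
    smoothFn.eval x (S.gbN d A A') = toSpinor (fun k => conj (S.ghpForm d x k)) A A' := by
  rw [gbN, smoothFn.eval_conj, eval_gN, toSpinor_conj]

theorem toSpinor_ghpScalar (S : SpinSpacetime M) (d : SpinDyad M) (p q : ℤ) (f : smoothFn M)
    (x : M) (A A' : Fin 2) :
    toSpinor (S.ghpScalar d p q f x) A A' =
      smoothFn.eval x (S.eN A A' f + (p * S.gN d A A' + q * S.gbN d A A') * f) := by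
  have hf : (f : M → ℂ) x = smoothFn.eval x f := rfl
  simp only [map_add, map_mul, map_intCast, eval_eN, eval_gN, eval_gbN, toSpinor, ghpScalar,
    Fin.sum_univ_four, hf]
  ring

theorem along_ghpScalar (S : SpinSpacetime M) (d : SpinDyad M) (p q : ℤ) (f : smoothFn M)
    (v : M → Fin 2 → ℂ) (c : Fin 2 → smoothFn M)
    (hc : ∀ x A, conj (v x A) = smoothFn.eval x (c A)) :
    (fun x => along (d.o x) (v x) (S.ghpScalar d p q f x)) =
      (S.nullFrame.ghp d.oR c (S.gN d) (S.gbN d) p q f : smoothFn M) := by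
  funext x
  change _ = smoothFn.eval x (∑ A, ∑ A', d.oR A * c A' *
    (S.eN A A' f + (p * S.gN d A A' + q * S.gbN d A A') * f))
  simp only [along, toSpinor_ghpScalar, map_sum, map_mul (smoothFn.eval x) (_ * _) _,
    map_mul (smoothFn.eval x) (d.oR _) _, d.eval_oR, hc]

theorem tho_eq (S : SpinSpacetime M) (d : SpinDyad M) (p q : ℤ) (f : smoothFn M) :
    S.tho d p q f = (S.nullFrame.ghp d.oR d.obR (S.gN d) (S.gbN d) p q f : smoothFn M) :=
  S.along_ghpScalar d p q f d.o d.obR fun _ _ => rfl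

theorem edt_eq (S : SpinSpacetime M) (d : SpinDyad M) (p q : ℤ) (f : smoothFn M) :
    S.edt d p q f = (S.nullFrame.ghp d.oR d.ibR (S.gN d) (S.gbN d) p q f : smoothFn M) :=
  S.along_ghpScalar d p q f d.ι d.ibR fun _ _ => rfl

theorem projScalar_eq (S : SpinSpacetime M) (d : SpinDyad M) (p : ℤ) (f : smoothFn M) (x : M)
    (A' : Fin 2) :
    S.projScalar d p 0 f x A' = smoothFn.eval x (S.nullFrame.proj d.oR (S.gN d) p f A') := by
  change _ = smoothFn.eval x (∑ A, d.oR A * (S.eN A A' f + p * S.gN d A A' * f))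
  simp [projScalar, toSpinor_ghpScalar, d.eval_oR]

theorem projPrimed_eq (S : SpinSpacetime M) (d : SpinDyad M) (p : ℤ) (Y : M → Fin 2 → ℂ)
    (y : Fin 2 → smoothFn M) (hY : ∀ B, (fun x => Y x B) = (y B : M → ℂ)) (x : M) (A' B' : Fin 2) :
    S.projPrimed d p 0 Y x A' B' =
      smoothFn.eval x (S.nullFrame.projSpinor d.oR (S.gN d) p y A' B') := by
  have hY' : ∀ B, Y x B = smoothFn.eval x (y B) := fun B => congrFun (hY B) x
  change _ = smoothFn.eval x (∑ A, d.oR A * (S.eN A A' (y B') - ∑ C', S.vN A A' B' C' * y C'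
    + p * S.gN d A A' * y B'))
  simp only [projPrimed, map_mul, map_add, map_sub, map_intCast, d.eval_oR, eval_eN,
    eval_vN, eval_gN, toSpinor, ghpPrimed, hY, hY', Fin.sum_univ_two, Fin.sum_univ_four]
  push_cast
  ring

end SpinSpacetime
end

noncomputable section

namespace NullFrame

variable {R : Type*} [CommRing R] [Algebra ℂ R] (N : NullFrame R)

/-- `∇_{AA'} κ^{B'}`. -/
def nabBar (b : Fin 2 → R) (A A' B' : Fin 2) : R := N.e A A' (b B') + ∑ C', b C' * N.v A A' C' B'

/-- `þ` of the component along `ō` of a primed spinor. -/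
theorem tho_contract_obar {o ob : Fin 2 → R} {g gb : Fin 2 → Fin 2 → R}
    (Ho : ∀ A B', ∑ A', ob A' * N.nabBar ob A A' B' = -(∑ A', ob A' * gb A A') * ob B')
    (p : ℤ) (y : Fin 2 → R) :
    N.ghp o ob g gb p 1 (∑ B', ob B' * y B') =
      ∑ A', ∑ B', ob A' * ob B' * N.projSpinor o g p y A' B' := by
  have h00 := Ho 0 0
  have h01 := Ho 0 1
  have h10 := Ho 1 0
  have h11 := Ho 1 1
  rw [ghp_sum]
  simp only [nabBar, Fin.sum_univ_two] at h00 h01 h10 h11 ⊢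
  push_cast
  linear_combination o 0 * y 0 * h00 + o 0 * y 1 * h01 + o 1 * y 0 * h10 + o 1 * y 1 * h11

/-- `þ` (for `c = ō`) or `ð` (for `c = ῑ`) of the component along `ῑ` of a primed spinor. -/
theorem ghp_contract_ibar {o ob ib : Fin 2 → R} {g gb mb : Fin 2 → Fin 2 → R}
    (Hi : ∀ A A' B', N.nabBar ib A A' B' = ob B' * mb A A' + ib B' * gb A A')
    (c : Fin 2 → R) (p : ℤ) (y : Fin 2 → R) :
    N.ghp o c g gb p (-1) (∑ B', ib B' * y B') =
      ∑ A', ∑ B', c A' * ib B' * N.projSpinor o g p y A' B'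
        + (∑ A, ∑ A', o A * c A' * mb A A') * ∑ B', ob B' * y B' := by
  simp only [nabBar] at Hi
  rw [ghp_sum]
  simp only [Hi]
  simp only [Fin.sum_univ_two]
  push_cast
  ring

end NullFrame

namespace SpinSpacetime

variable {M : Type*} [TopologicalSpace M] [ChartedSpace (EuclideanSpace ℝ (Fin 4)) M]
  [IsManifold (𝓡 4) ∞ M]

theorem kN_eq (S : SpinSpacetime M) (d : SpinDyad M) (A A' : Fin 2) :
    S.kN d A A' = S.nullFrame.pairing d.oR d.oR A A' := by
  simp only [kN, pair, nab₀, nab₁, NullFrame.pairing, NullFrame.nab, nullFrame, Fin.sum_univ_two,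
    wN_trace]
  ring

/-- `Θ̃_{A'} o^B = 0`. -/
theorem proj_o {S : SpinSpacetime M} {d : SpinDyad M}
    (hs : ∀ A', d.oR 0 * S.kN d 0 A' + d.oR 1 * S.kN d 1 A' = 0) (A' B : Fin 2) :
    ∑ A, d.oR A * S.nullFrame.nab d.oR A A' B = -(∑ A, d.oR A * S.gN d A A') * d.oR B := by
  have h := hs A'
  simp only [NullFrame.nab_o d.normR, gN, Fin.sum_univ_two, kN_eq] at h ⊢
  linear_combination -d.iR B * h

theorem conj_nab (S : SpinSpacetime M) (k : Fin 2 → smoothFn M) (A A' B : Fin 2) :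
    smoothFn.conj (S.nullFrame.nab k A A' B) =
      S.nullFrame.nabBar (fun C => smoothFn.conj (k C)) A' A B := by
  simp only [NullFrame.nab, NullFrame.nabBar, nullFrame, map_add, map_sum, map_mul, conj_eN, conj_wN]

theorem proj_obar {S : SpinSpacetime M} {d : SpinDyad M}
    (hs : ∀ A', d.oR 0 * S.kN d 0 A' + d.oR 1 * S.kN d 1 A' = 0) (A B' : Fin 2) :
    ∑ A', d.obR A' * S.nullFrame.nabBar d.obR A A' B' =
      -(∑ A', d.obR A' * S.gbN d A A') * d.obR B' := by
  have h := congrArg smoothFn.conj (proj_o hs A B')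
  simp only [map_sum, map_mul, map_neg, conj_nab] at h
  exact h

theorem nabBar_ibar (S : SpinSpacetime M) (d : SpinDyad M) (A A' B' : Fin 2) :
    S.nullFrame.nabBar d.ibR A A' B' =
      d.obR B' * smoothFn.conj (S.nullFrame.pairing d.iR d.iR A' A) + d.ibR B' * S.gbN d A A' := by
  have h := congrArg smoothFn.conj (NullFrame.nab_i (N := S.nullFrame) d.normR A' A B')
  rw [conj_nab, map_sub, map_mul, map_mul] at h
  simp only [gbN, gN, map_neg]
  refine Eq.trans h ?_
  simp only [SpinDyad.obR, SpinDyad.ibR]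
  ring

/-- `o^A o^B o^C ι^D X_{ABCD} = Ψ₁`. -/
theorem contract_curvN_eq_zero {S : SpinSpacetime M} {d : SpinDyad M} (hE : S.IsEinstein)
    (hII : S.IsTypeII d) :
    ∑ A, ∑ B, d.oR A * d.oR B *
      ∑ Q, d.oR Q * (d.iR 1 * S.curvN A 0 B 1 Q 0 - d.iR 0 * S.curvN A 0 B 1 Q 1) = 0 := by
  refine smoothFn.ext_eval fun x => ?_
  have low : ∀ (f : Fin 2 → ℂ), lowerIdx f 0 = -f 1 ∧ lowerIdx f 1 = f 0 := by
    intro f; constructor <;> simp [lowerIdx, spinEps]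
  have c0 : ∀ A B Q, smoothFn.eval x (S.curvN A 0 B 1 Q 0) = S.curvX A B Q 1 x := by
    intro A B Q; rw [curvX_eq hE.ricciTraceFree, (low _).2]
  have c1 : ∀ A B Q, smoothFn.eval x (S.curvN A 0 B 1 Q 1) = -S.curvX A B Q 0 x := by
    intro A B Q; rw [curvX_eq hE.ricciTraceFree, (low _).1, neg_neg]
  have h := (hII x).2.1
  obtain ⟨⟨⟨h0, h4⟩, ⟨h1, h1a, h1b, h1c⟩, h3, h3a, h3b, h3c⟩, ⟨ha, ha'⟩, hb, hb1, hb2, hb3⟩ :=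
    curvX_components hE.ricciTraceFree x
  simp only [Psi1, weylContract, weylSpinor, Fin.sum_univ_two, h0, h4, h1, h1a, h1b, h1c, h3, h3a,
    h3b, h3c, ha, ha', hb, hb1, hb2, hb3] at h
  simp only [map_add, map_mul, map_sub, c0, c1, map_zero, Fin.sum_univ_two, d.eval_oR, d.eval_iR]
  simp only [h0, h4, h1, h1a, h1b, h1c, h3, h3a, h3b, h3c, ha, ha', hb, hb1, hb2, hb3]
  linear_combination h

/-- The contracted curvature of the GHP connection form vanishes. -/
theorem contract_curl_gN {S : SpinSpacetime M} {d : SpinDyad M} (hE : S.IsEinstein)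
    (hII : S.IsTypeII d) (hs : ∀ A', d.oR 0 * S.kN d 0 A' + d.oR 1 * S.kN d 1 A' = 0) :
    ∑ A, ∑ B, d.oR A * d.oR B * (S.nullFrame.e A 0 (S.gN d B 1) - S.nullFrame.e B 1 (S.gN d A 0)
      - ∑ F, ∑ F', nullStruct S.nullFrame.w S.nullFrame.v A 0 B 1 F F' * S.gN d F F') = 0 := by
  have h := contract_curvN_eq_zero hE hII
  have c := fun A B => NullFrame.curl_pairing (N := S.nullFrame) d.normR A 0 B 1
  have hs0 := hs 0
  have hs1 := hs 1
  have c' : ∀ A B, S.nullFrame.e A 0 (S.gN d B 1) - S.nullFrame.e B 1 (S.gN d A 0)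
      - ∑ F, ∑ F', nullStruct S.nullFrame.w S.nullFrame.v A 0 B 1 F F' * S.gN d F F' =
      -((∑ Q, d.oR Q * (d.iR 1 * S.curvN A 0 B 1 Q 0 - d.iR 0 * S.curvN A 0 B 1 Q 1))
      + (S.nullFrame.pairing d.iR d.iR A 0 * S.kN d B 1
        - S.nullFrame.pairing d.iR d.iR B 1 * S.kN d A 0)) := by
    intro A B
    rw [kN_eq, kN_eq]
    refine Eq.trans ?_ (congrArg Neg.neg (c A B))
    simp only [gN, map_neg, Fin.sum_univ_two]
    ring
  simp only [c']
  simp only [Fin.sum_univ_two] at h ⊢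
  linear_combination -h - (d.oR 0 * S.nullFrame.pairing d.iR d.iR 0 0
    + d.oR 1 * S.nullFrame.pairing d.iR d.iR 1 0) * hs1
    + (d.oR 0 * S.nullFrame.pairing d.iR d.iR 0 1
    + d.oR 1 * S.nullFrame.pairing d.iR d.iR 1 1) * hs0

theorem along_connPair (S : SpinSpacetime M) (k l : Fin 2 → smoothFn M) (κ lam u v : M → Fin 2 → ℂ)
    (hk : ∀ x A, κ x A = smoothFn.eval x (k A)) (hl : ∀ A, (fun y => lam y A) = (l A : M → ℂ))
    (x : M) :
    along (u x) (v x) (S.connPair κ lam x) =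
      ∑ A, ∑ A', u x A * conj (v x A') * smoothFn.eval x (S.nullFrame.pairing k l A A') := by
  simp only [along, S.toSpinor_connPair k l κ lam hk hl]

end SpinSpacetime

theorem debye_metric_as_ooX {M : Type*} [TopologicalSpace M]
    [ChartedSpace (EuclideanSpace ℝ (Fin 4)) M] [IsManifold (𝓡 4) ∞ M]
    (S : SpinSpacetime M) (d : SpinDyad M) (hE : S.IsEinstein) (hII : S.IsTypeII d)
    (φ : M → ℂ) (hφ : ContMDiff (𝓡 4) 𝓘(ℝ, ℂ) ∞ φ) (hφΨ : ∀ x, φ x ^ 3 = S.Psi2 d x)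
    (χ : M → ℂ) (hχ : ContMDiff (𝓡 4) 𝓘(ℝ, ℂ) ∞ χ) (x : M) (A A' B B' : Fin 2) :
    S.debyeMetric d χ x A A' B B' =
      lowerIdx (d.o x) A * lowerIdx (d.o x) B * S.debyeX d φ χ x A' B' := by
  have hφ0 : φ x ≠ 0 := fun h0 => (hII x).2.2 (by rw [← hφΨ x, h0]; simp)
  obtain ⟨φ, rfl⟩ : ∃ f : smoothFn M, (f : M → ℂ) = φ := ⟨⟨φ, hφ⟩, rfl⟩
  obtain ⟨χ, rfl⟩ : ∃ f : smoothFn M, (f : M → ℂ) = χ := ⟨⟨χ, hχ⟩, rfl⟩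
  have hII' := S.typeII d hE hII φ hφΨ
  have hs := fun A' => (hII' A').1
  let y : Fin 2 → smoothFn M := S.nullFrame.proj d.oR (S.gN d) (-4) χ
  let T : Fin 2 → Fin 2 → smoothFn M := S.nullFrame.projSpinor d.oR (S.gN d) (-3) y
  let t : Fin 2 → smoothFn M := fun A' => ∑ A, d.iR A * S.kN d A A'
  have hT : ∀ A' B', T A' B' = T B' A' := S.nullFrame.projSpinor_proj_symm
    (SpinSpacetime.proj_o hs) (SpinSpacetime.contract_curl_gN hE hII hs) (-4) χ
  have ht : ∀ A', ∑ A, d.oR A * S.nullFrame.e A A' φ = φ * t A' := by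
    intro A'
    simp only [t, Fin.sum_univ_two]
    exact (hII' A').2
  let V : Fin 2 → Fin 2 → ℂ := fun A' B' =>
    -smoothFn.eval x (T A' B' + t A' * y B' + t B' * y A')
  have hX : ∀ A' B', S.debyeX d φ χ x A' B' = V A' B' := by
    intro A' B'
    have hY := S.projPrimed_eq d (-3) (S.debyeY d φ χ) (fun B => φ ^ 2 * y B)
      (fun B => funext fun x => congrArg (_ * ·) (S.projScalar_eq d (-4) χ x B)) x
    have hsq := S.nullFrame.projSpinor_sq_mul d.oR (S.gN d) (-3) y t φ ht
    have hφx : smoothFn.eval x φ ≠ 0 := hφ0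
    change -((smoothFn.eval x φ ^ 2)⁻¹ * _) = _
    rw [hY, hY, hsq, hsq]
    change -((smoothFn.eval x φ ^ 2)⁻¹ * ((smoothFn.eval x (φ ^ 2 * (T A' B' + 2 * t A' * y B'))
      + smoothFn.eval x (φ ^ 2 * (T B' A' + 2 * t B' * y A'))) / 2)) = _
    simp only [hT B' A', V, map_mul, map_add, map_pow, map_ofNat]
    field_simp
    ring
  have hτ : S.tau d x = ∑ A', conj (d.ι x A') * smoothFn.eval x (t A') := by
    rw [SpinSpacetime.tau, S.along_connPair d.oR d.oR d.o d.o d.ι d.ι (fun _ _ => rfl) fun _ => rfl]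
    simp only [t, map_add, map_mul, S.kN_eq, d.eval_iR, Fin.sum_univ_two]
    ring
  have hρ : S.rho d x = ∑ A', conj (d.o x A') * smoothFn.eval x (t A') := by
    rw [SpinSpacetime.rho, S.along_connPair d.oR d.oR d.o d.o d.ι d.o (fun _ _ => rfl) fun _ => rfl]
    simp only [t, map_add, map_mul, S.kN_eq, d.eval_iR, Fin.sum_univ_two]
    ring
  let mb : Fin 2 → Fin 2 → smoothFn M := fun A A' =>
    smoothFn.conj (S.nullFrame.pairing d.iR d.iR A' A)
  have hσ' : conj (S.sigma' d x) =
      -smoothFn.eval x (∑ A, ∑ A', d.oR A * d.ibR A' * mb A A') := by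
    rw [SpinSpacetime.sigma',
      S.along_connPair d.iR d.iR d.ι d.ι d.ι d.o (fun _ _ => rfl) fun _ => rfl]
    simp only [mb, map_neg, map_add, map_mul, smoothFn.eval_conj, SpinDyad.ibR, d.eval_iR,
      d.eval_oR, Fin.sum_univ_two, Complex.conj_conj]
    ring
  have hτ' : conj (S.tau' d x) =
      -smoothFn.eval x (∑ A, ∑ A', d.oR A * d.obR A' * mb A A') := by
    rw [SpinSpacetime.tau',
      S.along_connPair d.iR d.iR d.ι d.ι d.o d.o (fun _ _ => rfl) fun _ => rfl]
    simp only [mb, map_neg, map_add, map_mul, smoothFn.eval_conj, SpinDyad.obR,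
      d.eval_oR, Fin.sum_univ_two, Complex.conj_conj]
    ring
  have hobR : ∀ A, smoothFn.eval x (d.obR A) = conj (d.o x A) := fun _ => rfl
  have hibR : ∀ A, smoothFn.eval x (d.ibR A) = conj (d.ι x A) := fun _ => rfl
  have htho : S.tho d (-4) 0 χ = (∑ A', d.obR A' * y A' : smoothFn M) := by
    rw [S.tho_eq, NullFrame.ghp_eq_proj]
  have hedt : S.edt d (-4) 0 χ = (∑ A', d.ibR A' * y A' : smoothFn M) := by
    rw [S.edt_eq, NullFrame.ghp_eq_proj]
  have hmm : S.hmbarmbar d χ x = ∑ A', ∑ B', conj (d.o x A') * conj (d.o x B') * V A' B' := by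
    rw [SpinSpacetime.hmbarmbar, htho, S.tho_eq,
      S.nullFrame.tho_contract_obar (SpinSpacetime.proj_obar hs), hρ, ← smoothFn.eval_apply,
      ← smoothFn.eval_apply]
    simp only [V, map_add, map_mul, Fin.sum_univ_two, hobR]
    ring
  have hnm : S.hnmbar d χ x = ∑ A', ∑ B', conj (d.o x A') * conj (d.ι x B') * V A' B' := by
    rw [SpinSpacetime.hnmbar, htho, hedt, S.tho_eq,
      S.nullFrame.ghp_contract_ibar (S.nabBar_ibar d), hρ, hτ, hτ', ← smoothFn.eval_apply,
      ← smoothFn.eval_apply, ← smoothFn.eval_apply]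
    simp only [V, mb, map_add, map_mul, Fin.sum_univ_two, hobR, hibR]
    ring
  have hnn : S.hnn d χ x = ∑ A', ∑ B', conj (d.ι x A') * conj (d.ι x B') * V A' B' := by
    rw [SpinSpacetime.hnn, htho, hedt, S.edt_eq,
      S.nullFrame.ghp_contract_ibar (S.nabBar_ibar d), hτ, hσ', ← smoothFn.eval_apply,
      ← smoothFn.eval_apply, ← smoothFn.eval_apply]
    simp only [V, mb, map_add, map_mul, Fin.sum_univ_two, hobR, hibR]
    ring
  have hnorm : conj (d.o x 0) * conj (d.ι x 1) - conj (d.o x 1) * conj (d.ι x 0) = 1 := by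
    have h := congrArg (fun f => conj (smoothFn.eval x f)) d.normR
    simpa only [map_sub, map_mul, map_one, d.eval_oR, d.eval_iR] using h
  have hV : V 0 1 = V 1 0 := by
    simp only [V, hT 0 1]
    congr 2
    ring
  have hexp := symm_tensor_expand (o := fun A => conj (d.o x A)) (i := fun A => conj (d.ι x A))
    hnorm V hV (fun A => conj (lowerIdx (d.o x) A)) (fun A => conj (lowerIdx (d.ι x) A))
    (by simp [lowerIdx, spinEps]) (by simp [lowerIdx, spinEps]) (by simp [lowerIdx, spinEps])
    (by simp [lowerIdx, spinEps]) A' B'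
  rw [hX, SpinSpacetime.debyeMetric, SpinDyad.l, SpinDyad.l, SpinDyad.m, SpinDyad.m, hnn, hnm, hmm]
  linear_combination -(lowerIdx (d.o x) A * lowerIdx (d.o x) B) * hexp
end
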